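/- arXiv:2407.11092 — 2 statements merged into one kernel-verified Lean document; each statement's English description precedes it below -/
import Mathlib

section
/- Let Γ be a connected finite simple graph on m vertices with edge set E, and let N ≥ 2. Then the rank of H_{2(N−1)}(Conf_Γ(ℝ^N); ℤ) equals binom(|E|, 2) − s_3(Γ), where s_3(Γ) is the number of triangles of Γ (3-element vertex sets that are pairwise adjacent). -/
/-!
STATEMENT 14: For a connected finite simple graph Γ with edge set E and N ≥ 2,
rank H_{2(N−1)}(Conf_Γ(ℝ^N); ℤ) = binom(|E|, 2) − s₃(Γ),
where s₃(Γ) is the number of triangles of Γ.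
-/

open CategoryTheory

/-- Singular homology with integer coefficients, as a functor. -/
noncomputable def singularHomologyFunctor (d : ℕ) : TopCat ⥤ ModuleCat ℤ :=
  TopCat.toSSet ⋙ ((SimplicialObject.whiskering _ _).obj (ModuleCat.free ℤ)) ⋙
    AlgebraicTopology.alternatingFaceMapComplex (ModuleCat ℤ) ⋙
    HomologicalComplex.homologyFunctor (ModuleCat ℤ) (ComplexShape.down ℕ) d

/-- `SH d X` is the `d`-th integral singular homology group of `X`. -/
noncomputable abbrev SH (d : ℕ) (X : Type) [TopologicalSpace X] : ModuleCat ℤ :=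
  (singularHomologyFunctor d).obj (TopCat.of X)

/-- The chromatic configuration space `Conf_Γ(ℝ^N)`. -/
abbrev chromConf (N m : ℕ) (G : SimpleGraph (Fin m)) : Type :=
  {x : Fin m → EuclideanSpace ℝ (Fin N) // ∀ i j, G.Adj i j → x i ≠ x j}

/-- The number of triangles of `G`: 3-element vertex sets that are pairwise
adjacent. -/
noncomputable def triangleCount {m : ℕ} (G : SimpleGraph (Fin m)) : ℕ :=
  Nat.card {s : Finset (Fin m) //
    s.card = 3 ∧ ∀ i ∈ s, ∀ j ∈ s, i ≠ j → G.Adj i j}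

set_option linter.unusedSectionVars false

/-! ### Chains on tuples and abstract barycentric subdivision -/

namespace TupleChain

/-- Integral chains on `(n+1)`-tuples of elements of `Y`. -/
abbrev L (n : ℕ) (Y : Type) : Type := (Fin (n + 1) → Y) →₀ ℤ

variable {Y Y' : Type}

/-- The alternating-sum boundary of tuple chains. -/
noncomputable def d (n : ℕ) : L (n + 1) Y →ₗ[ℤ] L n Y :=
  Finsupp.linearCombination ℤ fun v =>
    ∑ i : Fin (n + 2), (-1 : ℤ) ^ (i : ℕ) • Finsupp.single (v ∘ i.succAbove) (1 : ℤ)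

lemma d_single (n : ℕ) (v : Fin (n + 2) → Y) :
    d n (Finsupp.single v 1) =
      ∑ i : Fin (n + 2), (-1 : ℤ) ^ (i : ℕ) • Finsupp.single (v ∘ i.succAbove) (1 : ℤ) := by
  simp [d]

/-- The cone operator with apex `b`. -/
noncomputable def cone (n : ℕ) (b : Y) : L n Y →ₗ[ℤ] L (n + 1) Y :=
  Finsupp.lmapDomain ℤ ℤ fun v => (Fin.cons b v : Fin (n + 2) → Y)

lemma cone_single (n : ℕ) (b : Y) (v : Fin (n + 1) → Y) :
    cone n b (Finsupp.single v 1) = Finsupp.single (Fin.cons b v : Fin (n + 2) → Y) 1 := by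
  simp [cone]

/-- The map on tuple chains induced by a function. -/
noncomputable def map (n : ℕ) (f : Y → Y') : L n Y →ₗ[ℤ] L n Y' :=
  Finsupp.lmapDomain ℤ ℤ fun v => f ∘ v

lemma map_single (n : ℕ) (f : Y → Y') (v : Fin (n + 1) → Y) :
    map n f (Finsupp.single v 1) = Finsupp.single (f ∘ v) 1 := by
  simp [map]

lemma hom_ext {n : ℕ} {M : Type*} [AddCommGroup M] {f g : L n Y →ₗ[ℤ] M}
    (h : ∀ v, f (Finsupp.single v 1) = g (Finsupp.single v 1)) : f = g :=
  Finsupp.lhom_ext' fun v => LinearMap.ext_ring (h v)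

lemma d_cone (n : ℕ) (b : Y) (c : L (n + 1) Y) :
    d (n + 1) (cone (n + 1) b c) = c - cone n b (d n c) := by
  have : d (n + 1) ∘ₗ cone (n + 1) b = LinearMap.id - cone n b ∘ₗ d n := by
    refine hom_ext fun v => ?_
    simp only [LinearMap.comp_apply, LinearMap.sub_apply, LinearMap.id_apply, cone_single,
      d_single, map_sum, map_zsmul]
    rw [Fin.sum_univ_succ]
    simp only [Fin.val_zero, pow_zero, one_smul, Fin.val_succ, pow_succ, mul_neg, mul_one,
      neg_smul, Finset.sum_neg_distrib, sub_eq_add_neg]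
    congr 1
    congr 1
    refine Finset.sum_congr rfl fun i _ => ?_
    congr 2
    funext j
    refine Fin.cases ?_ (fun j => ?_) j <;> simp
  exact LinearMap.congr_fun this c

/-- The endomorphism of `0`-chains collapsing every point to `b`. -/
noncomputable def augment (b : Y) : L 0 Y →ₗ[ℤ] L 0 Y :=
  Finsupp.linearCombination ℤ fun _ => Finsupp.single (fun _ => b) (1 : ℤ)

lemma d_cone_zero (b : Y) (c : L 0 Y) :
    d 0 (cone 0 b c) = c - augment b c := by
  have : d 0 ∘ₗ cone 0 b = LinearMap.id - augment b := by
    refine hom_ext fun v => ?_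
    have h₀ : (Fin.cons b v : Fin 2 → Y) ∘ (0 : Fin 2).succAbove = v := by
      funext j
      simp
    have h₁ : (Fin.cons b v : Fin 2 → Y) ∘ (1 : Fin 2).succAbove = fun _ => b := by
      funext j
      fin_cases j
      rfl
    rw [LinearMap.comp_apply, cone_single, d_single, Fin.sum_univ_two, h₀, h₁]
    simp only [Fin.val_zero, pow_zero, one_smul, Fin.val_one, pow_one, neg_smul, augment,
      Finsupp.linearCombination_single, sub_eq_add_neg, LinearMap.add_apply, LinearMap.neg_apply,
      LinearMap.id_apply]
  exact LinearMap.congr_fun this c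

lemma augment_d (b : Y) (c : L 1 Y) : augment b (d 0 c) = 0 := by
  have : augment b ∘ₗ d 0 = (0 : L 1 Y →ₗ[ℤ] L 0 Y) := by
    refine hom_ext fun v => ?_
    rw [LinearMap.comp_apply, d_single, Fin.sum_univ_two]
    simp [augment]
  exact LinearMap.congr_fun this c

lemma single_eq_cone (n : ℕ) (v : Fin (n + 2) → Y) :
    Finsupp.single v (1 : ℤ) = cone n (v 0) (Finsupp.single (Fin.tail v) 1) := by
  rw [cone_single, Fin.cons_self_tail]

lemma d_d (n : ℕ) (c : L (n + 2) Y) : d n (d (n + 1) c) = 0 := by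
  have : d n ∘ₗ d (n + 1) = (0 : L (n + 2) Y →ₗ[ℤ] L n Y) := by
    clear c
    induction n with
    | zero =>
      refine hom_ext fun v => ?_
      rw [LinearMap.comp_apply, single_eq_cone, d_cone, map_sub, d_cone_zero, augment_d]
      simp
    | succ n ih =>
      refine hom_ext fun v => ?_
      rw [LinearMap.comp_apply, single_eq_cone, d_cone, map_sub, d_cone]
      have := LinearMap.congr_fun ih (Finsupp.single (Fin.tail v) 1)
      simp only [LinearMap.comp_apply, LinearMap.zero_apply] at this
      simp [this]
  exact LinearMap.congr_fun this c

lemma map_d (n : ℕ) (f : Y → Y') (c : L (n + 1) Y) :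
    map n f (d n c) = d n (map (n + 1) f c) := by
  have : map n f ∘ₗ d n = d n ∘ₗ map (n + 1) f := by
    refine hom_ext fun v => ?_
    simp only [LinearMap.comp_apply, d_single, map_single, map_sum, map_zsmul,
      Function.comp_assoc]
  exact LinearMap.congr_fun this c

lemma map_cone (n : ℕ) (f : Y → Y') (b : Y) (c : L n Y) :
    map (n + 1) f (cone n b c) = cone n (f b) (map n f c) := by
  have : map (n + 1) f ∘ₗ cone n b = cone n (f b) ∘ₗ map n f := by
    refine hom_ext fun v => ?_
    simp only [LinearMap.comp_apply, cone_single, map_single]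
    congr 1
    ext j
    refine Fin.cases ?_ (fun j => ?_) j <;> simp
  exact LinearMap.congr_fun this c

variable (β : ∀ n, (Fin (n + 1) → Y) → Y)

/-- The chain homotopy between the identity and subdivision, where `β` picks the apex used to
subdivide a tuple. -/
noncomputable def T : ∀ n, L n Y →ₗ[ℤ] L (n + 1) Y
  | 0 => 0
  | n + 1 => Finsupp.linearCombination ℤ fun v =>
      cone (n + 1) (β (n + 1) v) (Finsupp.single v 1 - T n (d n (Finsupp.single v 1)))

lemma T_succ_single (n : ℕ) (v : Fin (n + 2) → Y) :
    T β (n + 1) (Finsupp.single v 1) =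
      cone (n + 1) (β (n + 1) v) (Finsupp.single v 1 - T β n (d n (Finsupp.single v 1))) := by
  simp [T]

/-- The subdivision operator. -/
noncomputable def S : ∀ n, L n Y →ₗ[ℤ] L n Y
  | 0 => LinearMap.id
  | n + 1 => LinearMap.id - d (n + 1) ∘ₗ T β (n + 1) - T β n ∘ₗ d n

lemma S_succ (n : ℕ) (c : L (n + 1) Y) :
    S β (n + 1) c = c - d (n + 1) (T β (n + 1) c) - T β n (d n c) := rfl

lemma S_d (n : ℕ) (c : L (n + 1) Y) : S β n (d n c) = d n c - d n (T β n (d n c)) := by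
  cases n with
  | zero => simp [S, T]
  | succ n => rw [S_succ, d_d]; simp

lemma S_succ_single (n : ℕ) (v : Fin (n + 2) → Y) :
    S β (n + 1) (Finsupp.single v 1) =
      cone n (β (n + 1) v) (S β n (d n (Finsupp.single v 1))) := by
  rw [S_succ, T_succ_single, d_cone, S_d, map_sub]
  abel

variable {β} {β' : ∀ n, (Fin (n + 1) → Y') → Y'}

lemma map_T {f : Y → Y'} (hf : ∀ n v, f (β n v) = β' n (f ∘ v)) (n : ℕ) (c : L n Y) :
    map (n + 1) f (T β n c) = T β' n (map n f c) := by
  have : map (n + 1) f ∘ₗ T β n = T β' n ∘ₗ map n f := by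
    clear c
    induction n with
    | zero => simp [T]
    | succ n ih =>
      refine hom_ext fun v => ?_
      have ih := LinearMap.congr_fun ih
      simp only [LinearMap.comp_apply] at ih ⊢
      rw [T_succ_single, map_cone, map_sub, ih, map_single, map_d, map_single, T_succ_single, hf]
  exact LinearMap.congr_fun this c

lemma map_S {f : Y → Y'} (hf : ∀ n v, f (β n v) = β' n (f ∘ v)) (n : ℕ) (c : L n Y) :
    map n f (S β n c) = S β' n (map n f c) := by
  cases n with
  | zero => rfl
  | succ n => simp only [S_succ, map_sub, map_d, map_T hf]

end TupleChain

namespace TupleChain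

section Mesh

variable {Y : Type} {β : ∀ n, (Fin (n + 1) → Y) → Y}

lemma cone_mem_supported {n : ℕ} {b : Y} {s : Set (Fin (n + 2) → Y)} {c : L n Y}
    (hc : c ∈ Finsupp.supported ℤ ℤ {w | (Fin.cons b w : Fin (n + 2) → Y) ∈ s}) :
    cone n b c ∈ Finsupp.supported ℤ ℤ s := by
  have h := Submodule.mem_map_of_mem (f := Finsupp.lmapDomain ℤ ℤ
    fun v => (Fin.cons b v : Fin (n + 2) → Y)) hc
  rw [Finsupp.lmapDomain_supported] at h
  exact Finsupp.supported_mono (by rintro _ ⟨w, hw, rfl⟩; exact hw) h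

lemma S_d_single_mem {n : ℕ} {v : Fin (n + 2) → Y} {s : Set (Fin (n + 1) → Y)}
    (h : ∀ i : Fin (n + 2), S β n (Finsupp.single (v ∘ i.succAbove) 1) ∈
      Finsupp.supported ℤ ℤ s) :
    S β n (d n (Finsupp.single v 1)) ∈ Finsupp.supported ℤ ℤ s := by
  rw [d_single, map_sum]
  refine Submodule.sum_mem _ fun i _ => ?_
  rw [map_zsmul]
  exact Submodule.smul_mem _ _ (h i)

variable [PseudoMetricSpace Y]

lemma S_single_mem_ball
    (hball : ∀ n (v : Fin (n + 1) → Y) x R, (∀ i, dist x (v i) ≤ R) → dist x (β n v) ≤ R)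
    (n : ℕ) (v : Fin (n + 1) → Y) :
    S β n (Finsupp.single v 1) ∈ Finsupp.supported ℤ ℤ
      {w | ∀ x R, (∀ i, dist x (v i) ≤ R) → ∀ j, dist x (w j) ≤ R} := by
  induction n with
  | zero => exact Finsupp.single_mem_supported _ _ fun x R h => h
  | succ n ih =>
    rw [S_succ_single]
    refine cone_mem_supported (S_d_single_mem fun i => Finsupp.supported_mono ?_ (ih _))
    intro w hw x R hR j
    refine Fin.cases ?_ (fun j => ?_) j
    · exact hball _ _ _ _ hR
    · exact hw x R (fun k => hR _) j

lemma S_single_mem_mesh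
    (hball : ∀ n (v : Fin (n + 1) → Y) x R, (∀ i, dist x (v i) ≤ R) → dist x (β n v) ≤ R)
    (hmesh : ∀ n (v : Fin (n + 1) → Y) D, (∀ i j, dist (v i) (v j) ≤ D) →
      ∀ i, dist (β n v) (v i) ≤ n / (n + 1) * D)
    (n : ℕ) (v : Fin (n + 1) → Y) (D : ℝ) (hv : ∀ i j, dist (v i) (v j) ≤ D) :
    S β n (Finsupp.single v 1) ∈ Finsupp.supported ℤ ℤ
      {w | ∀ i j, dist (w i) (w j) ≤ n / (n + 1) * D} := by
  have hD : 0 ≤ D := dist_nonneg.trans (hv 0 0)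
  induction n with
  | zero =>
    refine Finsupp.single_mem_supported _ _ fun i j => ?_
    have : i = j := Subsingleton.elim (α := Fin 1) i j
    simp [this]
  | succ n ih =>
    rw [S_succ_single]
    refine cone_mem_supported (S_d_single_mem fun i => ?_)
    have h₁ := ih (v ∘ i.succAbove) fun _ _ => hv _ _
    have h₂ := S_single_mem_ball hball n (v ∘ i.succAbove)
    have h₃ := (Finsupp.supported_inter (M := ℤ) (R := ℤ) _ _).ge ⟨h₁, h₂⟩
    refine Finsupp.supported_mono ?_ h₃
    rintro w ⟨hw₁, hw₂⟩
    have hb : ∀ j, dist (β (n + 1) v) (w j) ≤ ((n + 1 : ℕ) : ℝ) / ((n + 1 : ℕ) + 1) * D :=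
      hw₂ _ _ fun k => hmesh _ _ _ hv _
    have hq : (n : ℝ) / (n + 1) * D ≤ ((n + 1 : ℕ) : ℝ) / ((n + 1 : ℕ) + 1) * D := by
      refine mul_le_mul_of_nonneg_right ?_ hD
      push_cast
      rw [div_le_div_iff₀ (by positivity) (by positivity)]
      nlinarith
    have h0 : 0 ≤ ((n + 1 : ℕ) : ℝ) / ((n + 1 : ℕ) + 1) * D := by positivity
    intro j k
    refine Fin.cases ?_ (fun j => ?_) j <;> refine Fin.cases ?_ (fun k => ?_) k
    · simpa using h0
    · simpa using hb k
    · simpa [dist_comm] using hb j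
    · simpa using (hw₁ j k).trans hq

lemma S_iterate_mem_mesh
    (hball : ∀ n (v : Fin (n + 1) → Y) x R, (∀ i, dist x (v i) ≤ R) → dist x (β n v) ≤ R)
    (hmesh : ∀ n (v : Fin (n + 1) → Y) D, (∀ i j, dist (v i) (v j) ≤ D) →
      ∀ i, dist (β n v) (v i) ≤ n / (n + 1) * D)
    (n : ℕ) (v : Fin (n + 1) → Y) (D : ℝ) (hv : ∀ i j, dist (v i) (v j) ≤ D) (r : ℕ) :
    (S β n)^[r] (Finsupp.single v 1) ∈ Finsupp.supported ℤ ℤ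
      {w | ∀ i j, dist (w i) (w j) ≤ (n / (n + 1) : ℝ) ^ r * D} := by
  induction r with
  | zero => exact Finsupp.single_mem_supported _ _ (by simpa using hv)
  | succ r ih =>
    rw [Function.iterate_succ_apply']
    rw [Finsupp.supported_eq_span_single] at ih
    refine (Submodule.span_le (p := (Finsupp.supported ℤ ℤ _).comap (S β n))).2 ?_ ih
    rintro _ ⟨w, hw, rfl⟩
    have := S_single_mem_mesh hball hmesh n w _ hw
    rwa [← mul_assoc, ← pow_succ'] at this

end Mesh

end TupleChain

/-! ### Affine singular simplices -/

namespace AffSimplex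

/-- The topological simplex. -/
abbrev Δ (n : ℕ) : Type := stdSimplex ℝ (Fin (n + 1))

variable {n m p : ℕ}

/-- The affine map of simplices with prescribed vertices. -/
noncomputable def aff (v : Fin (n + 1) → Δ m) : C(Δ n, Δ m) where
  toFun t := ⟨∑ i, t.1 i • (v i).1,
    (convex_stdSimplex ℝ _).sum_mem (fun i _ => t.2.1 i) t.2.2 fun i _ => (v i).2⟩
  continuous_toFun := by
    refine Continuous.subtype_mk (continuous_finsetSum _ fun i _ => ?_) _
    exact ((continuous_apply i).comp continuous_subtype_val).smul continuous_const

lemma aff_val (v : Fin (n + 1) → Δ m) (t : Δ n) : (aff v t).1 = ∑ i, t.1 i • (v i).1 := rfl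

lemma aff_aff (w : Fin (m + 1) → Δ p) (v : Fin (n + 1) → Δ m) (t : Δ n) :
    aff w (aff v t) = aff (aff w ∘ v) t := by
  apply Subtype.ext
  simp only [aff_val, Function.comp_apply, Finset.sum_apply, Finset.sum_smul, Finset.smul_sum,
    Pi.smul_apply, smul_eq_mul, mul_smul]
  rw [Finset.sum_comm]

/-- The vertices of the standard simplex. -/
noncomputable def verts (n : ℕ) : Fin (n + 1) → Δ n := fun i => stdSimplex.vertex i

lemma verts_val (i : Fin (n + 1)) : (verts n i).1 = Pi.single i 1 := stdSimplex.vertex_coe i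

lemma aff_verts : aff (verts n) = ContinuousMap.id _ := by
  ext t : 1
  apply Subtype.ext
  funext j
  simp [aff_val, verts_val, Finset.sum_apply, Pi.single_apply]

lemma aff_vert (v : Fin (n + 1) → Δ m) (i : Fin (n + 1)) : aff v (verts n i) = v i := by
  apply Subtype.ext
  simp [aff_val, verts_val, Pi.single_apply]

/-- The inclusion of the `i`-th face. -/
noncomputable def face (i : Fin (n + 2)) : C(Δ n, Δ (n + 1)) :=
  ⟨stdSimplex.map i.succAbove, stdSimplex.continuous_map _⟩

lemma face_eq_aff (i : Fin (n + 2)) : face i = aff (verts (n + 1) ∘ i.succAbove) := by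
  ext t : 1
  apply Subtype.ext
  funext j
  have : (face i t).1 = FunOnFinite.linearMap ℝ ℝ i.succAbove t.1 := rfl
  rw [this, FunOnFinite.linearMap_apply_apply]
  simp [aff_val, verts_val, Finset.sum_apply, Pi.single_apply, Finset.sum_filter, eq_comm]

lemma aff_comp_face (v : Fin (n + 2) → Δ m) (i : Fin (n + 2)) :
    (aff v).comp (face i) = aff (v ∘ i.succAbove) := by
  ext t : 1
  rw [face_eq_aff, ContinuousMap.comp_apply, aff_aff]
  congr 2
  funext j
  simp [aff_vert]

/-- The barycenter of a tuple of points of a simplex. -/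
noncomputable def bary (n : ℕ) (v : Fin (n + 1) → Δ m) : Δ m := aff v stdSimplex.barycenter

lemma aff_bary (w : Fin (m + 1) → Δ p) (n : ℕ) (v : Fin (n + 1) → Δ m) :
    aff w (bary n v) = bary n (aff w ∘ v) := aff_aff _ _ _

lemma dist_aff_le (v : Fin (n + 1) → Δ m) (t : Δ n) (x : Δ m) (R : ℝ)
    (h : ∀ i, dist x (v i) ≤ R) : dist x (aff v t) ≤ R := by
  rw [dist_comm, Subtype.dist_eq, aff_val, ← Metric.mem_closedBall]
  refine (convex_closedBall _ _).sum_mem (fun i _ => t.2.1 i) t.2.2 fun i _ => ?_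
  rw [Metric.mem_closedBall, ← Subtype.dist_eq, dist_comm]
  exact h i

lemma dist_bary_le (n : ℕ) (v : Fin (n + 1) → Δ m) (D : ℝ) (h : ∀ i j, dist (v i) (v j) ≤ D)
    (i : Fin (n + 1)) : dist (bary n v) (v i) ≤ n / (n + 1) * D := by
  rw [Subtype.dist_eq, dist_eq_norm, bary, aff_val]
  have h₁ : ∑ j, (stdSimplex.barycenter : Δ n).1 j • (v j).1 - (v i).1 =
      ∑ j, (1 / (n + 1) : ℝ) • ((v j).1 - (v i).1) := by
    rw [← Finset.smul_sum, Finset.sum_sub_distrib, smul_sub, Finset.smul_sum]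
    congr 1
    · refine Finset.sum_congr rfl fun j _ => ?_
      congr 1
      exact (stdSimplex.barycenter_apply j).trans (by simp)
    · rw [Finset.sum_const, Finset.card_univ, Fintype.card_fin, ← Nat.cast_smul_eq_nsmul ℝ,
        smul_smul]
      push_cast
      rw [one_div_mul_cancel (by positivity), one_smul]
  rw [h₁, ← Finset.add_sum_erase _ _ (Finset.mem_univ i), sub_self, smul_zero, zero_add]
  refine (norm_sum_le_of_le _ (n := fun _ => 1 / (n + 1) * D) fun j _ => ?_).trans ?_
  · rw [norm_smul, ← dist_eq_norm, ← Subtype.dist_eq, Real.norm_of_nonneg (by positivity)]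
    exact mul_le_mul_of_nonneg_left (h j i) (by positivity)
  · rw [Finset.sum_const, Finset.card_erase_of_mem (Finset.mem_univ i)]
    simp
    apply le_of_eq
    ring

end AffSimplex

/-! ### Concrete singular chains and small simplices -/

namespace SingChain

open TupleChain AffSimplex

/-- Concrete singular chains. -/
abbrev SC (X : Type) [TopologicalSpace X] (n : ℕ) : Type := C(Δ n, X) →₀ ℤ

variable {X : Type} [TopologicalSpace X] {m n : ℕ}

lemma hom_ext {M : Type*} [AddCommGroup M] {f g : SC X n →ₗ[ℤ] M}
    (h : ∀ σ, f (Finsupp.single σ 1) = g (Finsupp.single σ 1)) : f = g :=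
  Finsupp.lhom_ext' fun v => LinearMap.ext_ring (h v)

/-- The singular boundary operator. -/
noncomputable def bd (X : Type) [TopologicalSpace X] (n : ℕ) : SC X (n + 1) →ₗ[ℤ] SC X n :=
  Finsupp.linearCombination ℤ fun σ =>
    ∑ i : Fin (n + 2), (-1 : ℤ) ^ (i : ℕ) • Finsupp.single (σ.comp (face i)) (1 : ℤ)

lemma bd_single (σ : C(Δ (n + 1), X)) :
    bd X n (Finsupp.single σ 1) =
      ∑ i : Fin (n + 2), (-1 : ℤ) ^ (i : ℕ) • Finsupp.single (σ.comp (face i)) (1 : ℤ) := by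
  simp [bd]

/-- Realization of tuple chains in a simplex as singular chains, pushed forward along `σ`. -/
noncomputable def real (σ : C(Δ m, X)) (n : ℕ) : L n (Δ m) →ₗ[ℤ] SC X n :=
  Finsupp.lmapDomain ℤ ℤ fun v => σ.comp (aff v)

lemma real_single (σ : C(Δ m, X)) (v : Fin (n + 1) → Δ m) :
    real σ n (Finsupp.single v 1) = Finsupp.single (σ.comp (aff v)) 1 := by
  simp [real]

lemma real_verts (σ : C(Δ n, X)) :
    real σ n (Finsupp.single (verts n) 1) = Finsupp.single σ 1 := by
  rw [real_single, aff_verts, ContinuousMap.comp_id]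

lemma real_d (σ : C(Δ m, X)) (c : L (n + 1) (Δ m)) :
    real σ n (d n c) = bd X n (real σ (n + 1) c) := by
  have : real σ n ∘ₗ d n = bd X n ∘ₗ real σ (n + 1) := by
    refine TupleChain.hom_ext fun v => ?_
    simp only [LinearMap.comp_apply, d_single, real_single, map_sum, map_zsmul, bd_single,
      ContinuousMap.comp_assoc, aff_comp_face]
  exact LinearMap.congr_fun this c

lemma real_map (σ : C(Δ m, X)) {p : ℕ} (w : Fin (p + 1) → Δ m) (c : L n (Δ p)) :
    real σ n (map n (aff w) c) = real (σ.comp (aff w)) n c := by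
  have : real σ n ∘ₗ map n (aff w) = real (σ.comp (aff w)) n := by
    refine TupleChain.hom_ext fun v => ?_
    simp only [LinearMap.comp_apply, map_single, real_single]
    congr 1
    ext t : 1
    simp [aff_aff]
  exact LinearMap.congr_fun this c

/-- Singular subdivision homotopy. -/
noncomputable def Ts (X : Type) [TopologicalSpace X] (n : ℕ) : SC X n →ₗ[ℤ] SC X (n + 1) :=
  Finsupp.linearCombination ℤ fun σ =>
    real σ (n + 1) (T (fun k => bary k) n (Finsupp.single (verts n) 1))

/-- Singular subdivision. -/
noncomputable def Ss (X : Type) [TopologicalSpace X] (n : ℕ) : SC X n →ₗ[ℤ] SC X n :=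
  Finsupp.linearCombination ℤ fun σ =>
    real σ n (S (fun k => bary k) n (Finsupp.single (verts n) 1))

lemma Ts_real (σ : C(Δ m, X)) (c : L n (Δ m)) :
    Ts X n (real σ n c) = real σ (n + 1) (T (fun k => bary k) n c) := by
  have : Ts X n ∘ₗ real σ n = real σ (n + 1) ∘ₗ T (fun k => bary k) n := by
    refine TupleChain.hom_ext fun v => ?_
    simp only [LinearMap.comp_apply, real_single, Ts, Finsupp.linearCombination_single, one_smul]
    rw [← real_map, map_T (β' := fun k => bary k) fun _ _ => aff_bary _ _ _, map_single]
    congr 3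
    funext i
    simp [aff_vert]
  exact LinearMap.congr_fun this c

lemma Ss_real (σ : C(Δ m, X)) (c : L n (Δ m)) :
    Ss X n (real σ n c) = real σ n (S (fun k => bary k) n c) := by
  have : Ss X n ∘ₗ real σ n = real σ n ∘ₗ S (fun k => bary k) n := by
    refine TupleChain.hom_ext fun v => ?_
    simp only [LinearMap.comp_apply, real_single, Ss, Finsupp.linearCombination_single, one_smul]
    rw [← real_map, map_S (β' := fun k => bary k) fun _ _ => aff_bary _ _ _, map_single]
    congr 3
    funext i
    simp [aff_vert]
  exact LinearMap.congr_fun this c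

lemma Ss_zero (c : SC X 0) : Ss X 0 c = c := by
  have : Ss X 0 = LinearMap.id := hom_ext fun σ => by
    rw [← real_verts, Ss_real]
    rfl
  exact LinearMap.congr_fun this c

lemma Ss_succ (c : SC X (n + 1)) :
    Ss X (n + 1) c = c - bd X (n + 1) (Ts X (n + 1) c) - Ts X n (bd X n c) := by
  have : Ss X (n + 1) = LinearMap.id - bd X (n + 1) ∘ₗ Ts X (n + 1) - Ts X n ∘ₗ bd X n :=
    hom_ext fun σ => by
      simp only [LinearMap.comp_apply, LinearMap.sub_apply, LinearMap.id_apply]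
      rw [← real_verts, Ss_real, Ts_real, ← real_d, ← real_d, Ts_real, S_succ]
      simp only [map_sub]
  exact LinearMap.congr_fun this c

lemma bd_bd (c : SC X (n + 2)) : bd X n (bd X (n + 1) c) = 0 := by
  have : bd X n ∘ₗ bd X (n + 1) = (0 : SC X (n + 2) →ₗ[ℤ] SC X n) := hom_ext fun σ => by
    rw [LinearMap.comp_apply, ← real_verts, ← real_d, ← real_d, d_d]
    simp
  exact LinearMap.congr_fun this c

/-- Chains of simplices contained in `W`. -/
noncomputable def chainsIn (W : Set X) (n : ℕ) : Submodule ℤ (SC X n) :=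
  Finsupp.supported ℤ ℤ {σ | ∀ t, σ t ∈ W}

lemma real_mem (W : Set X) {σ : C(Δ m, X)} (hσ : ∀ t, σ t ∈ W) (c : L n (Δ m)) :
    real σ n c ∈ chainsIn W n := by
  have h := Submodule.mem_map_of_mem (f := Finsupp.lmapDomain ℤ ℤ
    fun v => σ.comp (aff v)) ((Finsupp.mem_supported ℤ (s := Set.univ) c).2 (Set.subset_univ _))
  rw [Finsupp.lmapDomain_supported] at h
  exact Finsupp.supported_mono (by rintro _ ⟨w, hw, rfl⟩ t; exact hσ _) h

lemma map_mem_of_single {W : Set X} {f : SC X n →ₗ[ℤ] SC X m}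
    (h : ∀ σ : C(Δ n, X), (∀ t, σ t ∈ W) → f (Finsupp.single σ 1) ∈ chainsIn W m)
    {c : SC X n} (hc : c ∈ chainsIn W n) : f c ∈ chainsIn W m := by
  rw [chainsIn, Finsupp.supported_eq_span_single] at hc
  refine (Submodule.span_le (p := (chainsIn W m).comap f)).2 ?_ hc
  rintro _ ⟨w, hw, rfl⟩
  exact h w hw

lemma bd_mem {W : Set X} {c : SC X (n + 1)} (hc : c ∈ chainsIn W (n + 1)) :
    bd X n c ∈ chainsIn W n :=
  map_mem_of_single (fun σ hσ => by rw [← real_verts, ← real_d]; exact real_mem W hσ _) hc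

lemma Ts_mem {W : Set X} {c : SC X n} (hc : c ∈ chainsIn W n) : Ts X n c ∈ chainsIn W (n + 1) :=
  map_mem_of_single (fun σ hσ => by rw [← real_verts, Ts_real]; exact real_mem W hσ _) hc

lemma Ss_mem {W : Set X} {c : SC X n} (hc : c ∈ chainsIn W n) : Ss X n c ∈ chainsIn W n :=
  map_mem_of_single (fun σ hσ => by rw [← real_verts, Ss_real]; exact real_mem W hσ _) hc

variable {U V : Set X}

lemma sup_mem {f : SC X n →ₗ[ℤ] SC X m}
    (hf : ∀ (W : Set X) {c}, c ∈ chainsIn W n → f c ∈ chainsIn W m)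
    {c : SC X n} (hc : c ∈ chainsIn U n ⊔ chainsIn V n) :
    f c ∈ chainsIn U m ⊔ chainsIn V m := by
  obtain ⟨u, hu, v, hv, rfl⟩ := Submodule.mem_sup.1 hc
  rw [map_add]
  exact Submodule.add_mem_sup (hf U hu) (hf V hv)

lemma Ss_iterate_mem {c : SC X n} (hc : c ∈ chainsIn U n ⊔ chainsIn V n) (r : ℕ) :
    (Ss X n)^[r] c ∈ chainsIn U n ⊔ chainsIn V n := by
  induction r with
  | zero => exact hc
  | succ r ih =>
    rw [Function.iterate_succ_apply']
    exact sup_mem (fun W _ h => Ss_mem h) ih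

lemma Ss_iterate_real (σ : C(Δ m, X)) (c : L n (Δ m)) (r : ℕ) :
    (Ss X n)^[r] (real σ n c) = real σ n ((S (fun k => bary k) n)^[r] c) := by
  induction r with
  | zero => rfl
  | succ r ih => rw [Function.iterate_succ_apply', ih, Ss_real, Function.iterate_succ_apply']

lemma exists_iterate_single_mem (hU : IsOpen U) (hV : IsOpen V) (hUV : U ∪ V = Set.univ)
    (σ : C(Δ n, X)) :
    ∃ r, (Ss X n)^[r] (Finsupp.single σ 1) ∈ chainsIn U n ⊔ chainsIn V n := by
  obtain ⟨δ, hδ, hleb⟩ := lebesgue_number_lemma_of_metric (s := (Set.univ : Set (Δ n)))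
    (c := fun b : Bool => σ ⁻¹' (if b then U else V)) isCompact_univ
    (by rintro (_ | _)
        · simpa using hV.preimage σ.continuous
        · simpa using hU.preimage σ.continuous)
    (by intro t _
        have : σ t ∈ U ∪ V := hUV ▸ Set.mem_univ _
        rcases this with h | h
        · exact Set.mem_iUnion.2 ⟨true, by simpa using h⟩
        · exact Set.mem_iUnion.2 ⟨false, by simpa using h⟩)
  obtain ⟨D, hD⟩ : ∃ D, ∀ i j, dist (verts n i) (verts n j) ≤ D :=
    ⟨Metric.diam (Set.univ : Set (Δ n)), fun i j =>
      Metric.dist_le_diam_of_mem isCompact_univ.isBounded (Set.mem_univ _) (Set.mem_univ _)⟩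
  have hlim : Filter.Tendsto (fun r : ℕ => (n / (n + 1) : ℝ) ^ r * D) Filter.atTop (nhds 0) := by
    have := (tendsto_pow_atTop_nhds_zero_of_lt_one (r := (n / (n + 1) : ℝ)) (by positivity)
      (by rw [div_lt_one (by positivity)]; linarith)).mul_const D
    simpa using this
  obtain ⟨r, hr⟩ := (hlim.eventually (gt_mem_nhds hδ)).exists
  refine ⟨r, ?_⟩
  have hmem := S_iterate_mem_mesh (β := fun k => bary (m := n) k)
    (fun k v x R h => dist_aff_le v _ x R h) (fun k v D h i => dist_bary_le k v D h i)
    n (verts n) D hD r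
  rw [← real_verts, Ss_iterate_real]
  rw [Finsupp.supported_eq_span_single] at hmem
  refine (Submodule.span_le (p := (chainsIn U n ⊔ chainsIn V n).comap (real σ n))).2 ?_ hmem
  rintro _ ⟨w, hw, rfl⟩
  change real σ n (Finsupp.single w 1) ∈ chainsIn U n ⊔ chainsIn V n
  rw [real_single]
  obtain ⟨b, hb⟩ := hleb (w 0) (Set.mem_univ _)
  have hin : ∀ t, σ (aff w t) ∈ (if b then U else V) := fun t => hb <| by
    rw [Metric.mem_ball, dist_comm]
    exact (dist_aff_le w t (w 0) _ fun i => hw 0 i).trans_lt hr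
  cases b
  · exact Submodule.mem_sup_right (Finsupp.single_mem_supported _ _ (by simpa using hin))
  · exact Submodule.mem_sup_left (Finsupp.single_mem_supported _ _ (by simpa using hin))

lemma exists_iterate_mem (hU : IsOpen U) (hV : IsOpen V) (hUV : U ∪ V = Set.univ) (c : SC X n) :
    ∃ r, (Ss X n)^[r] c ∈ chainsIn U n ⊔ chainsIn V n := by
  have hlin : ∀ r, ⇑((Ss X n) ^ r) = (Ss X n)^[r] := fun r => Module.End.coe_pow _ _
  induction c using Finsupp.induction_linear with
  | zero => exact ⟨0, Submodule.zero_mem _⟩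
  | add f g hf hg =>
    obtain ⟨r, hr⟩ := hf
    obtain ⟨s, hs⟩ := hg
    refine ⟨r + s, ?_⟩
    rw [← hlin, map_add, hlin]
    refine Submodule.add_mem _ ?_ ?_
    · rw [add_comm r s, Function.iterate_add_apply]
      exact Ss_iterate_mem hr s
    · rw [Function.iterate_add_apply]
      exact Ss_iterate_mem hs r
  | single σ a =>
    obtain ⟨r, hr⟩ := exists_iterate_single_mem hU hV hUV σ
    refine ⟨r, ?_⟩
    have : Finsupp.single σ a = a • Finsupp.single σ (1 : ℤ) := by simp
    rw [this, ← hlin, map_zsmul, hlin]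
    exact Submodule.smul_mem _ _ hr

lemma mem_small_zero (hU : IsOpen U) (hV : IsOpen V) (hUV : U ∪ V = Set.univ) (c : SC X 0) :
    c ∈ chainsIn U 0 ⊔ chainsIn V 0 := by
  obtain ⟨r, hr⟩ := exists_iterate_mem hU hV hUV c
  have : (Ss X 0)^[r] c = c := by
    rw [show ⇑(Ss X 0) = id from funext Ss_zero, Function.iterate_id, id]
  rwa [this] at hr

/-- Every chain with small boundary is small up to a boundary. -/
lemma exists_sub_bd_mem (hU : IsOpen U) (hV : IsOpen V) (hUV : U ∪ V = Set.univ)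
    (c : SC X (n + 1)) (hc : bd X n c ∈ chainsIn U n ⊔ chainsIn V n) :
    ∃ w, c - bd X (n + 1) w ∈ chainsIn U (n + 1) ⊔ chainsIn V (n + 1) := by
  obtain ⟨r, hr⟩ := exists_iterate_mem hU hV hUV c
  induction r generalizing c with
  | zero => exact ⟨0, by simpa using hr⟩
  | succ r ih =>
    rw [Function.iterate_succ_apply] at hr
    have hT := sup_mem (f := Ts X n) (fun W _ h => Ts_mem h) hc
    obtain ⟨w, hw⟩ := ih (Ss X (n + 1) c) (by
      rw [Ss_succ, map_sub, map_sub, bd_bd, sub_zero]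
      exact Submodule.sub_mem _ hc (sup_mem (fun W _ h => bd_mem h) hT)) hr
    refine ⟨w + Ts X (n + 1) c, ?_⟩
    have := Submodule.add_mem _ hw hT
    rw [Ss_succ] at this
    rw [map_add]
    convert this using 1
    abel

end SingChain

/-! ### Comparison of the singular chain complex with concrete chains -/

/-- The singular chain complex functor with integer coefficients. -/
noncomputable def singularChains : TopCat.{0} ⥤ ChainComplex (ModuleCat ℤ) ℕ :=
  TopCat.toSSet ⋙ ((SimplicialObject.whiskering _ _).obj (ModuleCat.free ℤ)) ⋙
    AlgebraicTopology.alternatingFaceMapComplex (ModuleCat ℤ)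

namespace SingChain

open AffSimplex

variable {X Y : TopCat.{0}} {n : ℕ}

/-- The chains of the singular chain complex identify with concrete chains. -/
noncomputable def equiv (X : TopCat.{0}) (n : ℕ) :
    (singularChains.obj X).X n ≃ₗ[ℤ] SC X n :=
  Finsupp.domLCongr (X.toSSetObjEquiv (Opposite.op (SimplexCategory.mk n)))

lemma equiv_symm_single (σ : C(Δ n, X)) :
    (equiv X n).symm (Finsupp.single σ 1) = (ModuleCat.freeMk
      ((X.toSSetObjEquiv (Opposite.op (SimplexCategory.mk n))).symm σ)) :=
  Finsupp.domLCongr_single _ _ _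

lemma equiv_freeMk (s : (TopCat.toSSet.obj X).obj (Opposite.op (SimplexCategory.mk n))) :
    equiv X n (ModuleCat.freeMk s) = Finsupp.single (X.toSSetObjEquiv _ s) 1 :=
  Finsupp.domLCongr_single _ _ _

lemma equiv_d (c : (singularChains.obj X).X (n + 1)) :
    equiv X n ((singularChains.obj X).d (n + 1) n c) = bd X n (equiv X (n + 1) c) := by
  have : (equiv X n).toLinearMap ∘ₗ ((singularChains.obj X).d (n + 1) n).hom ∘ₗ
      (equiv X (n + 1)).symm.toLinearMap = bd X n := by
    refine hom_ext fun σ => ?_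
    rw [LinearMap.comp_apply, LinearMap.comp_apply, LinearEquiv.coe_coe, LinearEquiv.coe_coe,
      equiv_symm_single, bd_single]
    have h : (singularChains.obj X).d (n + 1) n = ∑ i : Fin (n + 2), (-1 : ℤ) ^ (i : ℕ) •
        (ModuleCat.free ℤ).map ((TopCat.toSSet.obj X).δ i) := by
      simp only [singularChains, Functor.comp_obj,
        AlgebraicTopology.alternatingFaceMapComplex_obj_d]
      rfl
    have h' (x : (ModuleCat.free ℤ).obj ((TopCat.toSSet.obj X).obj
        (Opposite.op (SimplexCategory.mk (n + 1))))) :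
        (singularChains.obj X).d (n + 1) n x = ∑ i : Fin (n + 2), (-1 : ℤ) ^ (i : ℕ) •
          (show (singularChains.obj X).X n from
            (ModuleCat.free ℤ).map ((TopCat.toSSet.obj X).δ i) x) := by
      refine (LinearMap.congr_fun (congrArg ModuleCat.Hom.hom h) x).trans ?_
      refine (LinearMap.congr_fun (ModuleCat.hom_sum _ _) x).trans ?_
      exact LinearMap.sum_apply _ _ _
    refine (congrArg _ (h' _)).trans ?_
    rw [map_sum]
    refine Finset.sum_congr rfl fun i _ => ?_
    rw [map_zsmul]
    congr 1
    erw [ModuleCat.free_map_apply, equiv_freeMk]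
    rfl
  have h := LinearMap.congr_fun this (equiv X (n + 1) c)
  simpa using h

lemma equiv_map (f : X ⟶ Y) (c : (singularChains.obj X).X n) :
    equiv Y n ((singularChains.map f).f n c) =
      Finsupp.mapDomain (fun σ : C(Δ n, X) => f.hom.comp σ) (equiv X n c) := by
  have : (equiv Y n).toLinearMap ∘ₗ ((singularChains.map f).f n).hom ∘ₗ
      (equiv X n).symm.toLinearMap = Finsupp.lmapDomain ℤ ℤ fun σ : C(Δ n, X) => f.hom.comp σ := by
    refine hom_ext fun σ => ?_
    rw [LinearMap.comp_apply, LinearMap.comp_apply, LinearEquiv.coe_coe, LinearEquiv.coe_coe,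
      equiv_symm_single, Finsupp.lmapDomain_apply, Finsupp.mapDomain_single]
    change equiv Y n ((ModuleCat.free ℤ).map ((TopCat.toSSet.map f).app _) _) = _
    erw [ModuleCat.free_map_apply, equiv_freeMk]
    rfl
  have h := LinearMap.congr_fun this (equiv X n c)
  simpa using h

end SingChain

/-! ### Relative homology -/

section Cokernels

open Limits

variable {C : Type*} [Category C] [Abelian C]

/-- The sequence of cokernels of `f`, `f ≫ g` and `g`. -/
noncomputable def cokerSequence {X Y Z : C} (f : X ⟶ Y) (g : Y ⟶ Z) (h : X ⟶ Z) (w : f ≫ g = h) :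
    ShortComplex C :=
  ShortComplex.mk
    ((coker C).map (Arrow.homMk (𝟙 X) g (by simp [w]) : Arrow.mk f ⟶ Arrow.mk h))
    ((coker C).map (Arrow.homMk f (𝟙 Z) (by simp [w]) : Arrow.mk h ⟶ Arrow.mk g))
    (by
      refine coequalizer.hom_ext ?_
      simp [coker]
      exact Limits.comp_zero.symm)

lemma cokerSequence_shortExact {X Y Z : C} (f : X ⟶ Y) (g : Y ⟶ Z) (h : X ⟶ Z) (w : f ≫ g = h)
    [Mono g] : (cokerSequence f g h w).ShortExact := by
  subst w
  have e1 : (cokerSequence f g _ rfl).f = (kernelCokernelCompSequence.snakeInput f g).L₃.f := by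
    refine coequalizer.hom_ext ?_
    simp [cokerSequence, coker]
  have e2 : (cokerSequence f g _ rfl).g = (kernelCokernelCompSequence.snakeInput f g).L₃.g := by
    refine coequalizer.hom_ext ?_
    simp [cokerSequence, coker]
  have hL := (kernelCokernelCompSequence.snakeInput f g).L₃_exact
  have hex : (cokerSequence f g _ rfl).Exact :=
    (ShortComplex.exact_iff_of_iso (ShortComplex.isoMk (Iso.refl _) (Iso.refl _) (Iso.refl _)
      
      ((Category.id_comp _).trans (e1.symm.trans (Category.comp_id _).symm))
      ((Category.id_comp _).trans (e2.symm.trans (Category.comp_id _).symm)))).2 hL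
  have hmono : Mono (cokerSequence f g _ rfl).f := by
    rw [e1]
    refine (kernelCokernelCompSequence.snakeInput f g).L₂'_exact.mono_g ?_
    refine IsZero.eq_of_src ?_ _ _
    exact (isZero_kernel_of_mono g)
  have hepi : Epi (cokerSequence f g _ rfl).g := by
    have : Epi (cokernel.π (f ≫ g) ≫ (cokerSequence f g _ rfl).g) := by
      have : cokernel.π (f ≫ g) ≫ (cokerSequence f g _ rfl).g = cokernel.π g := by
        simp [cokerSequence, coker]
      rw [this]; exact coequalizer.π_epi
    exact epi_of_epi (cokernel.π (f ≫ g)) _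
  exact { exact := hex, mono_f := hmono, epi_g := hepi }

end Cokernels

namespace SingChain

open Limits

instance mono_singularChains {A X : TopCat.{0}} (i : A ⟶ X) [Mono i] :
    Mono (singularChains.map i) := by
  have : ∀ n, Mono ((singularChains.map i).f n) := fun n => by
    rw [ModuleCat.mono_iff_injective]
    intro a b hab
    have h := congrArg (equiv X n) hab
    rw [equiv_map, equiv_map] at h
    refine (equiv A n).injective (Finsupp.mapDomain_injective ?_ h)
    intro σ τ hst
    ext t
    exact (TopCat.mono_iff_injective i).1 inferInstance (DFunLike.congr_fun hst t)
  exact HomologicalComplex.mono_of_mono_f _ this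

/-- The relative singular chains of a map. -/
noncomputable def relF : Arrow TopCat.{0} ⥤ ChainComplex (ModuleCat ℤ) ℕ :=
  singularChains.mapArrow ⋙ coker _

/-- The short complex of a pair. -/
noncomputable def pairSeq : Arrow TopCat.{0} ⥤ ShortComplex (ChainComplex (ModuleCat ℤ) ℕ) where
  obj i := ShortComplex.mk (singularChains.map i.hom) (cokernel.π _) (cokernel.condition _)
  map {i j} φ :=
    { τ₁ := singularChains.map φ.left
      τ₂ := singularChains.map φ.right
      τ₃ := relF.map φ
      comm₁₂ := by simp [← Functor.map_comp]
      comm₂₃ := (cokernel.π_desc _ _ _).symm }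
  map_id i := by ext1 <;> (simp; try rfl)
  map_comp φ ψ := by ext1 <;> (simp; try rfl)

lemma pairSeq_shortExact (i : Arrow TopCat.{0}) [Mono i.hom] : (pairSeq.obj i).ShortExact where
  exact := ShortComplex.exact_cokernel _
  mono_f := mono_singularChains i.hom
  epi_g := coequalizer.π_epi

/-- The short complex of a triple. -/
noncomputable def tripleSeq {A B X : TopCat.{0}} (i : A ⟶ B) (j : B ⟶ X) :
    ShortComplex (ChainComplex (ModuleCat ℤ) ℕ) :=
  ShortComplex.mk
    (relF.map (Arrow.homMk (𝟙 A) j : Arrow.mk i ⟶ Arrow.mk (i ≫ j)))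
    (relF.map (Arrow.homMk i (𝟙 X) : Arrow.mk (i ≫ j) ⟶ Arrow.mk j))
    (by
      rw [← Functor.map_comp]
      refine coequalizer.hom_ext ((cokernel.π_desc _ _ _).trans ?_)
      refine Eq.trans ?_ (Limits.comp_zero (f := cokernel.π (singularChains.map i))).symm
      simp
      exact cokernel.condition (singularChains.map j))

lemma tripleSeq_shortExact {A B X : TopCat.{0}} (i : A ⟶ B) (j : B ⟶ X) [Mono j] :
    (tripleSeq i j).ShortExact := by
  have h := cokerSequence_shortExact (singularChains.map i) (singularChains.map j)
    (singularChains.map (i ≫ j)) (singularChains.map_comp i j).symm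
  refine ShortComplex.shortExact_of_iso
    (S₁ := cokerSequence (singularChains.map i) (singularChains.map j)
      (singularChains.map (i ≫ j)) (singularChains.map_comp i j).symm)
    (ShortComplex.isoMk (Iso.refl _) (Iso.refl _) (Iso.refl _) ?_ ?_) h
  · refine (Category.id_comp _).trans (Eq.trans ?_ (Category.comp_id _).symm)
    refine coequalizer.hom_ext ?_
    refine (cokernel.π_desc _ _ _).trans (Eq.trans ?_ (cokernel.π_desc _ _ _).symm)
    rfl
  · refine (Category.id_comp _).trans (Eq.trans ?_ (Category.comp_id _).symm)
    refine coequalizer.hom_ext ?_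
    refine (cokernel.π_desc _ _ _).trans (Eq.trans ?_ (cokernel.π_desc _ _ _).symm)
    simp
    rfl

/-- Functoriality of the short complex of a triple. -/
noncomputable def tripleMap {A B X A' B' X' : TopCat.{0}} {i : A ⟶ B} {j : B ⟶ X}
    {i' : A' ⟶ B'} {j' : B' ⟶ X'} (a : A ⟶ A') (b : B ⟶ B') (x : X ⟶ X')
    (h₁ : a ≫ i' = i ≫ b) (h₂ : b ≫ j' = j ≫ x) :
    tripleSeq i j ⟶ tripleSeq i' j' where
  τ₁ := relF.map (Arrow.homMk a b h₁ : Arrow.mk i ⟶ Arrow.mk i')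
  τ₂ := relF.map (Arrow.homMk a x (by simp [reassoc_of% h₁, h₂]) :
    Arrow.mk (i ≫ j) ⟶ Arrow.mk (i' ≫ j'))
  τ₃ := relF.map (Arrow.homMk b x h₂ : Arrow.mk j ⟶ Arrow.mk j')
  comm₁₂ := by
    dsimp only [tripleSeq]
    rw [← Functor.map_comp, ← Functor.map_comp]
    congr 1
    ext1 <;> simp [h₂]
  comm₂₃ := by
    dsimp only [tripleSeq]
    rw [← Functor.map_comp, ← Functor.map_comp]
    congr 1
    ext1 <;> simp [h₁]

lemma homologyMap_eq_of_homotopic {X Y : Type} [TopologicalSpace X] [TopologicalSpace Y]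
    {f g : C(X, Y)} (h : f.Homotopic g) (k : ℕ) :
    HomologicalComplex.homologyMap (singularChains.map (TopCat.ofHom f)) k =
      HomologicalComplex.homologyMap (singularChains.map (TopCat.ofHom g)) k := by
  obtain ⟨H⟩ := h
  let H' : TopCat.Homotopy (TopCat.ofHom f) (TopCat.ofHom g) := H
  exact (SimplicialObject.Homotopy.toChainHomotopy
    (H'.toSSet.toSimplicialObjectHomotopy.whiskerRight (ModuleCat.free ℤ))).homologyMap_eq k

lemma quasiIso_of_homotopyInverse {X Y : Type} [TopologicalSpace X] [TopologicalSpace Y]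
    (f : C(X, Y)) (g : C(Y, X)) (h₁ : (g.comp f).Homotopic (ContinuousMap.id X))
    (h₂ : (f.comp g).Homotopic (ContinuousMap.id Y)) :
    QuasiIso (singularChains.map (TopCat.ofHom f)) := by
  rw [quasiIso_iff]
  intro k
  rw [quasiIsoAt_iff_isIso_homologyMap]
  refine ⟨HomologicalComplex.homologyMap (singularChains.map (TopCat.ofHom g)) k, ?_, ?_⟩
  · rw [← HomologicalComplex.homologyMap_comp, ← Functor.map_comp, ← TopCat.ofHom_comp,
      homologyMap_eq_of_homotopic h₁, TopCat.ofHom_id, CategoryTheory.Functor.map_id,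
      HomologicalComplex.homologyMap_id]
  · rw [← HomologicalComplex.homologyMap_comp, ← Functor.map_comp, ← TopCat.ofHom_comp,
      homologyMap_eq_of_homotopic h₂, TopCat.ofHom_id, CategoryTheory.Functor.map_id,
      HomologicalComplex.homologyMap_id]

lemma quasiIso_relF {i j : Arrow TopCat.{0}} [Mono i.hom] [Mono j.hom] (φ : i ⟶ j)
    (h₁ : QuasiIso (singularChains.map φ.left)) (h₂ : QuasiIso (singularChains.map φ.right)) :
    QuasiIso (relF.map φ) :=
  HomologicalComplex.HomologySequence.quasiIso_τ₃ (pairSeq.map φ) (pairSeq_shortExact i)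
    (pairSeq_shortExact j) h₁ h₂

lemma acyclic_relF (i : Arrow TopCat.{0}) [Mono i.hom] (h : QuasiIso (singularChains.map i.hom)) :
    (relF.obj i).Acyclic :=
  (pairSeq_shortExact i).acyclic_X₃ h

end SingChain

/-! ### Excision -/

namespace SingChain

open Limits AffSimplex

lemma cokernel_f_surjective {K L : ChainComplex (ModuleCat ℤ) ℕ} (φ : K ⟶ L) (n : ℕ) :
    Function.Surjective ((cokernel.π φ).f n) := by
  have : Epi (cokernel.π φ) := coequalizer.π_epi
  exact (ModuleCat.epi_iff_surjective _).1 inferInstance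

lemma cokernel_f_eq_zero_iff {K L : ChainComplex (ModuleCat ℤ) ℕ} (φ : K ⟶ L) (n : ℕ) (c : L.X n) :
    (cokernel.π φ).f n c = 0 ↔ ∃ b, φ.f n b = c := by
  have h : (ShortComplex.mk φ (cokernel.π φ) (cokernel.condition φ)).Exact :=
    ShortComplex.exact_cokernel φ
  have h' := h.map_of_epi_of_preservesCokernel (HomologicalComplex.eval (ModuleCat ℤ) _ n)
    coequalizer.π_epi inferInstance
  rw [ShortComplex.moduleCat_exact_iff] at h'
  constructor
  · exact h' c
  · rintro ⟨b, rfl⟩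
    have := congrArg (fun ψ => HomologicalComplex.Hom.f ψ n) (cokernel.condition φ)
    exact ConcreteCategory.congr_hom this b

variable {X Y : TopCat.{0}} {n : ℕ}

lemma exists_map_eq_iff (u : X ⟶ Y) (hu : Topology.IsEmbedding u) (c : (singularChains.obj Y).X n) :
    (∃ b, (singularChains.map u).f n b = c) ↔ equiv Y n c ∈ chainsIn (Set.range u) n := by
  have hS : {σ : C(Δ n, Y) | ∀ t, σ t ∈ Set.range u} =
      (fun σ : C(Δ n, X) => u.hom.comp σ) '' Set.univ := by
    ext σ
    simp only [Set.mem_ofPred_eq, Set.image_univ, Set.mem_range]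
    constructor
    · intro h
      choose f hf using h
      refine ⟨⟨f, hu.continuous_iff.2 ?_⟩, ?_⟩
      · convert σ.continuous using 1
        exact funext hf
      · ext t
        exact hf t
    · rintro ⟨τ, rfl⟩ t
      exact ⟨τ t, rfl⟩
  rw [chainsIn, hS, ← Finsupp.lmapDomain_supported, Submodule.mem_map]
  constructor
  · rintro ⟨b, rfl⟩
    exact ⟨equiv X n b, by simp [Finsupp.supported_univ], (equiv_map u b).symm⟩
  · rintro ⟨b, -, hb⟩
    refine ⟨(equiv X n).symm b, (equiv Y n).injective ?_⟩
    rw [equiv_map, LinearEquiv.apply_symm_apply]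
    exact hb

/-- Excision for open subspaces. -/
theorem quasiIso_excision {W U V X : TopCat.{0}} (a : W ⟶ V) (b : W ⟶ U) (v : V ⟶ X) (u : U ⟶ X)
    (w : b ≫ u = a ≫ v) (hu : Topology.IsOpenEmbedding u) (hv : Topology.IsOpenEmbedding v)
    (huv : Set.range u ∪ Set.range v = Set.univ) (ha : Topology.IsEmbedding a)
    (hrange : Set.range a = v ⁻¹' Set.range u) :
    QuasiIso (relF.map (Arrow.homMk b v w : Arrow.mk a ⟶ Arrow.mk u)) := by
  have hπ (n : ℕ) (c : (singularChains.obj V).X n) :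
      (relF.map (Arrow.homMk b v w : Arrow.mk a ⟶ Arrow.mk u)).f n
        ((cokernel.π (singularChains.map a)).f n c) =
      (cokernel.π (singularChains.map u)).f n ((singularChains.map v).f n c) :=
    ConcreteCategory.congr_hom (congrArg (fun ψ => HomologicalComplex.Hom.f ψ n)
      (cokernel.π_desc (singularChains.map a) _ _)) c
  generalize hφ : relF.map (Arrow.homMk b v w : Arrow.mk a ⟶ Arrow.mk u) = φ at hπ ⊢
  have hmono : Mono φ := by
    refine HomologicalComplex.mono_of_mono_f _ fun n => ?_
    rw [ModuleCat.mono_iff_injective, injective_iff_map_eq_zero]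
    intro z hz
    obtain ⟨c, rfl⟩ := cokernel_f_surjective (singularChains.map a) n z
    refine (cokernel_f_eq_zero_iff (singularChains.map a) n c).2 ?_
    rw [exists_map_eq_iff a ha, hrange]
    rw [hπ] at hz
    have hz := (cokernel_f_eq_zero_iff (singularChains.map u) n _).1 hz
    rw [exists_map_eq_iff u hu.isEmbedding, equiv_map, chainsIn, Finsupp.mem_supported] at hz
    rw [chainsIn, Finsupp.mem_supported]
    intro σ hσ t
    classical
    rw [Finsupp.mapDomain_support_of_injective] at hz
    · exact hz (Finset.mem_coe.2 (Finset.mem_image_of_mem _ hσ)) t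
    · intro σ τ h
      ext t
      exact hv.injective (DFunLike.congr_fun h t)
  have hker (n : ℕ) (c : (singularChains.obj X).X n) :
      (cokernel.π φ).f n ((cokernel.π (singularChains.map u)).f n c) = 0 ↔
        equiv X n c ∈ chainsIn (Set.range u) n ⊔ chainsIn (Set.range v) n := by
    refine (cokernel_f_eq_zero_iff φ n _).trans ?_
    constructor
    · rintro ⟨z, hz⟩
      obtain ⟨d, rfl⟩ := cokernel_f_surjective (singularChains.map a) n z
      rw [hπ] at hz
      have h0 : (cokernel.π (singularChains.map u)).f n (c - (singularChains.map v).f n d) = 0 := by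
        rw [map_sub, hz, sub_self]
      have h1 := (exists_map_eq_iff u hu.isEmbedding _).1
        ((cokernel_f_eq_zero_iff (singularChains.map u) n _).1 h0)
      have h2 := (exists_map_eq_iff v hv.isEmbedding _).1 ⟨d, rfl⟩
      rw [map_sub] at h1
      simpa using Submodule.add_mem_sup h1 h2
    · intro h
      obtain ⟨x, hx, y, hy, hxy⟩ := Submodule.mem_sup.1 h
      obtain ⟨x', rfl⟩ := (equiv X n).surjective x
      obtain ⟨y', rfl⟩ := (equiv X n).surjective y
      rw [← map_add] at hxy
      obtain rfl := (equiv X n).injective hxy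
      have h1 := (cokernel_f_eq_zero_iff (singularChains.map u) n x').2
        ((exists_map_eq_iff u hu.isEmbedding _).2 hx)
      obtain ⟨d, rfl⟩ := (exists_map_eq_iff v hv.isEmbedding _).2 hy
      exact ⟨(cokernel.π (singularChains.map a)).f n d, by rw [hπ, map_add, h1, zero_add]⟩
  have hS : (ShortComplex.mk φ (cokernel.π φ) (cokernel.condition φ)).ShortExact :=
    { exact := ShortComplex.exact_cokernel φ
      mono_f := hmono
      epi_g := coequalizer.π_epi }
  have hsurj (n : ℕ) (z : (cokernel φ).X n) :
      ∃ c, (cokernel.π φ).f n ((cokernel.π (singularChains.map u)).f n c) = z := by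
    obtain ⟨y, rfl⟩ := cokernel_f_surjective φ n z
    obtain ⟨c, rfl⟩ := cokernel_f_surjective (singularChains.map u) n y
    exact ⟨c, rfl⟩
  have hacyc : (cokernel φ).Acyclic := by
    have hcomm {A B : ChainComplex (ModuleCat ℤ) ℕ} (ψ : A ⟶ B) (i j : ℕ) (x : A.X i) :
        B.d i j (ψ.f i x) = ψ.f j (A.d i j x) := ConcreteCategory.congr_hom (ψ.comm i j) x
    have hd (i j : ℕ) (c : (singularChains.obj X).X i) :
        (cokernel φ).d i j ((cokernel.π φ).f i ((cokernel.π (singularChains.map u)).f i c)) =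
          (cokernel.π φ).f j ((cokernel.π (singularChains.map u)).f j
            ((singularChains.obj X).d i j c)) :=
      (hcomm _ _ _ _).trans (congrArg _ (hcomm (cokernel.π (singularChains.map u)) _ _ _))
    intro n
    cases n with
    | zero =>
      rw [HomologicalComplex.exactAt_iff' _ 1 0 _ (by simp) rfl,
        ShortComplex.moduleCat_exact_iff]
      intro z hz
      obtain ⟨c, rfl⟩ := hsurj 0 z
      refine ⟨0, ?_⟩
      rw [map_zero]
      exact ((hker 0 c).2 (mem_small_zero hu.isOpen_range hv.isOpen_range huv _)).symm
    | succ n =>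
      rw [HomologicalComplex.exactAt_iff' _ (n + 2) (n + 1) n (by simp) (by simp),
        ShortComplex.moduleCat_exact_iff]
      intro z hz
      obtain ⟨c, rfl⟩ := hsurj (n + 1) z
      have hz' := (hker _ _).1 ((hd _ _ c).symm.trans hz)
      rw [equiv_d] at hz'
      obtain ⟨e, he⟩ := exists_sub_bd_mem hu.isOpen_range hv.isOpen_range huv _ hz'
      obtain ⟨e, rfl⟩ := (equiv X (n + 2)).surjective e
      rw [← equiv_d, ← map_sub] at he
      have he' := (hker _ _).2 he
      rw [map_sub] at he'
      replace he' := (map_sub ((cokernel.π φ).f (n + 1)).hom _ _).symm.trans he'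
      exact ⟨(cokernel.π φ).f _ ((cokernel.π (singularChains.map u)).f _ e),
        (hd _ _ _).trans (sub_eq_zero.1 he').symm⟩
  rw [quasiIso_iff]
  intro n
  rw [quasiIsoAt_iff_isIso_homologyMap]
  have hz (k) : IsZero ((cokernel φ).homology k) := (hacyc k).isZero_homology
  have h1 : Mono (HomologicalComplex.homologyMap φ n) :=
    (hS.homology_exact₁ (n + 1) n rfl).mono_g ((hz (n + 1)).eq_of_src _ _)
  have h2 : Epi (HomologicalComplex.homologyMap φ n) :=
    (hS.homology_exact₂ n).epi_f ((hz n).eq_of_tgt _ _)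
  exact isIso_of_mono_of_epi _

end SingChain

/-! ### The Thom isomorphism for trivial bundles -/

namespace SingChain

open Limits

section Pairs

variable {X Y Z : Type} [TopologicalSpace X] [TopologicalSpace Y] [TopologicalSpace Z]

/-- The inclusion between subspaces. -/
def incl {A B : Set X} (h : A ⊆ B) : TopCat.of A ⟶ TopCat.of B :=
  TopCat.ofHom ⟨Set.inclusion h, continuous_inclusion h⟩

instance {A B : Set X} (h : A ⊆ B) : Mono (incl h) :=
  (TopCat.mono_iff_injective _).2 (Set.inclusion_injective h)

instance {A B : Set X} (h : A ⊆ B) : Mono (Arrow.mk (incl h)).hom :=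
  (TopCat.mono_iff_injective _).2 (Set.inclusion_injective h)

/-- The restriction of a continuous map to subspaces. -/
def restr (f : C(X, Y)) {A : Set X} {B : Set Y} (h : Set.MapsTo f A B) : C(A, B) :=
  ⟨h.restrict f A B, f.continuous.restrict h⟩

/-- The map of pairs induced by a continuous map. -/
def pairMap (f : C(X, Y)) {A A' : Set X} {B B' : Set Y} {hA : A ⊆ A'} {hB : B ⊆ B'}
    (h : Set.MapsTo f A B) (h' : Set.MapsTo f A' B') :
    Arrow.mk (incl hA) ⟶ Arrow.mk (incl hB) :=
  Arrow.homMk (TopCat.ofHom (restr f h)) (TopCat.ofHom (restr f h')) rfl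

lemma pairMap_comp_pairMap {Y' : Type} [TopologicalSpace Y'] {A A' : Set X} {B B' : Set Y}
    {C C' : Set Z} {D D' : Set Y'} {hA : A ⊆ A'} {hB : B ⊆ B'} {hC : C ⊆ C'} {hD : D ⊆ D'}
    (f : C(X, Y)) (g : C(Y, Z)) (f' : C(X, Y')) (g' : C(Y', Z))
    (h₁ : Set.MapsTo f A B) (h₁' : Set.MapsTo f A' B') (h₂ : Set.MapsTo g B C)
    (h₂' : Set.MapsTo g B' C') (h₃ : Set.MapsTo f' A D) (h₃' : Set.MapsTo f' A' D')
    (h₄ : Set.MapsTo g' D C) (h₄' : Set.MapsTo g' D' C')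
    (h : ∀ x ∈ A', g (f x) = g' (f' x)) :
    (pairMap f h₁ h₁' : Arrow.mk (incl hA) ⟶ Arrow.mk (incl hB)) ≫
        (pairMap g h₂ h₂' : Arrow.mk (incl hB) ⟶ Arrow.mk (incl hC)) =
      (pairMap f' h₃ h₃' : Arrow.mk (incl hA) ⟶ Arrow.mk (incl hD)) ≫
        (pairMap g' h₄ h₄' : Arrow.mk (incl hD) ⟶ Arrow.mk (incl hC)) := by
  ext x
  · exact Subtype.ext (h x.1 (hA x.2))
  · exact Subtype.ext (h x.1 x.2)

lemma quasiIso_restr (f : C(X, Y)) (g : C(Y, X)) {A : Set X} {B : Set Y}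
    (hf : Set.MapsTo f A B) (hg : Set.MapsTo g B A)
    (F : C(unitInterval × X, X)) (G : C(unitInterval × Y, Y))
    (hF : ∀ t, ∀ x ∈ A, F (t, x) ∈ A) (hG : ∀ t, ∀ y ∈ B, G (t, y) ∈ B)
    (hF0 : ∀ x ∈ A, F (0, x) = g (f x)) (hF1 : ∀ x ∈ A, F (1, x) = x)
    (hG0 : ∀ x ∈ B, G (0, x) = f (g x)) (hG1 : ∀ x ∈ B, G (1, x) = x) :
    QuasiIso (singularChains.map (TopCat.ofHom (restr f hf))) := by
  refine quasiIso_of_homotopyInverse (restr f hf) (restr g hg) ⟨?_⟩ ⟨?_⟩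
  · exact
      { toFun := fun p => ⟨F (p.1, p.2.1), hF _ _ p.2.2⟩
        continuous_toFun := by fun_prop
        map_zero_left := fun x => Subtype.ext (hF0 x x.2)
        map_one_left := fun x => Subtype.ext (hF1 x x.2) }
  · exact
      { toFun := fun p => ⟨G (p.1, p.2.1), hG _ _ p.2.2⟩
        continuous_toFun := by fun_prop
        map_zero_left := fun x => Subtype.ext (hG0 x x.2)
        map_one_left := fun x => Subtype.ext (hG1 x x.2) }

lemma isIso_homologyMap {K L : ChainComplex (ModuleCat ℤ) ℕ} {φ : K ⟶ L} (h : QuasiIso φ) (k : ℕ) :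
    IsIso (HomologicalComplex.homologyMap φ k) :=
  inferInstance

lemma nonempty_arrowIso_of_quasiIso {i j i' j' : Arrow TopCat.{0}} (φ : i ⟶ j) (φ' : i' ⟶ j')
    (ψ : i ⟶ i') (ψ' : j ⟶ j') (w : ψ ≫ φ' = φ ≫ ψ') (h : QuasiIso (relF.map ψ))
    (h' : QuasiIso (relF.map ψ')) (k : ℕ) :
    Nonempty (Arrow.mk (HomologicalComplex.homologyMap (relF.map φ) k) ≅
      Arrow.mk (HomologicalComplex.homologyMap (relF.map φ') k)) :=
  ⟨Arrow.isoMk (asIso (HomologicalComplex.homologyMap (relF.map ψ) k))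
    (asIso (HomologicalComplex.homologyMap (relF.map ψ') k))
    (by simp [← HomologicalComplex.homologyMap_comp, ← Functor.map_comp, w])⟩

end Pairs

section Thom

variable (E F X Y : Type) [NormedAddCommGroup E] [NormedSpace ℝ E]
  [NormedAddCommGroup F] [NormedSpace ℝ F] [TopologicalSpace X] [TopologicalSpace Y]

/-- The complement of the zero section of a trivial bundle. -/
def offZero : Set (X × E) := {p | p.2 ≠ 0}

/-- The pair formed by a trivial bundle and the complement of its zero section. -/
def thomPair : Arrow TopCat.{0} := Arrow.mk (incl (Set.subset_univ (offZero E X)))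

variable {X Y}

/-- The map of trivial bundles induced by a map of the bases. -/
def thomMap (f : C(X, Y)) : thomPair E X ⟶ thomPair E Y :=
  pairMap (f.prodMap (ContinuousMap.id E)) (fun _ h => h) (fun _ _ => trivial)

/-- The Thom isomorphism in rank `n` for trivial bundles with fibre `E`, in natural form. -/
def HasThomIso (n : ℕ) : Prop :=
  (∀ (X Y : Type) [TopologicalSpace X] [TopologicalSpace Y] (f : C(X, Y)) (k : ℕ),
    Nonempty (Arrow.mk (HomologicalComplex.homologyMap (relF.map (thomMap E f)) (k + n)) ≅
      Arrow.mk (HomologicalComplex.homologyMap (singularChains.map (TopCat.ofHom f)) k))) ∧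
  ∀ (X : Type) [TopologicalSpace X] (k : ℕ), k < n →
    IsZero ((relF.obj (thomPair E X)).homology k)

variable {E F}

/-- The map of trivial bundles induced by an isomorphism of the fibres. -/
def thomFibreMap (e : E ≃L[ℝ] F) (X : Type) [TopologicalSpace X] :
    thomPair E X ⟶ thomPair F X :=
  pairMap ((ContinuousMap.id X).prodMap ⟨e, e.continuous⟩)
    (fun p hp => by simpa [offZero] using hp) (fun _ _ => trivial)

lemma thomFibreMap_naturality (e : E ≃L[ℝ] F) (f : C(X, Y)) :
    thomFibreMap e X ≫ thomMap F f = thomMap E f ≫ thomFibreMap e Y :=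
  pairMap_comp_pairMap _ _ _ _ _ _ _ _ _ _ _ _ fun _ _ => rfl

lemma quasiIso_thomFibreMap (e : E ≃L[ℝ] F) (X : Type) [TopologicalSpace X] :
    QuasiIso (relF.map (thomFibreMap e X)) := by
  have aux (A : Set (X × E)) (B : Set (X × F)) (hA : ∀ p ∈ A, (p.1, e p.2) ∈ B)
      (hB : ∀ p ∈ B, (p.1, e.symm p.2) ∈ A) : QuasiIso (singularChains.map (TopCat.ofHom (restr
        ((ContinuousMap.id X).prodMap ⟨e, e.continuous⟩) (A := A) (B := B) hA))) :=
    quasiIso_restr (A := A) (B := B) ((ContinuousMap.id X).prodMap ⟨e, e.continuous⟩)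
      ((ContinuousMap.id X).prodMap ⟨e.symm, e.symm.continuous⟩) hA hB
      ⟨Prod.snd, continuous_snd⟩ ⟨Prod.snd, continuous_snd⟩
      (fun _ _ h => h) (fun _ _ h => h)
      (fun p _ => Prod.ext rfl (e.symm_apply_apply _).symm) (fun p _ => rfl)
      (fun p _ => Prod.ext rfl (e.apply_symm_apply _).symm) (fun p _ => rfl)
  refine @quasiIso_relF _ _ (inferInstanceAs (Mono (incl _))) (inferInstanceAs (Mono (incl _))) _
    (aux _ _ _ ?_) (aux _ _ _ fun _ _ => trivial)
  intro p hp
  simpa [offZero] using hp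

lemma thom_congr (e : E ≃L[ℝ] F) (f : C(X, Y)) (k : ℕ) :
    Nonempty (Arrow.mk (HomologicalComplex.homologyMap (relF.map (thomMap E f)) k) ≅
      Arrow.mk (HomologicalComplex.homologyMap (relF.map (thomMap F f)) k)) :=
  nonempty_arrowIso_of_quasiIso _ _ _ _ (thomFibreMap_naturality e f)
    (quasiIso_thomFibreMap e X) (quasiIso_thomFibreMap e Y) k

lemma HasThomIso.congr {n : ℕ} (h : HasThomIso E n) (e : E ≃L[ℝ] F) : HasThomIso F n := by
  refine ⟨fun X Y _ _ f k => ?_, fun X _ k hk => ?_⟩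
  · obtain ⟨i⟩ := h.1 X Y f k
    obtain ⟨j⟩ := thom_congr e f (k + n)
    exact ⟨j.symm ≪≫ i⟩
  · obtain ⟨j⟩ := thom_congr e (ContinuousMap.id X) k
    exact (h.2 X k hk).of_iso (Arrow.leftFunc.mapIso j.symm)

lemma isZero_of_isEmpty (X : TopCat.{0}) [IsEmpty X] : IsZero (singularChains.obj X) := by
  rw [IsZero.iff_id_eq_zero]
  ext n : 1
  refine IsZero.eq_of_src ?_ _ _
  have : IsEmpty C(AffSimplex.Δ n, X) :=
    ⟨fun σ => isEmptyElim (σ (AffSimplex.verts n 0))⟩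
  have : Subsingleton ((singularChains.obj X).X n) := (equiv X n).toEquiv.subsingleton
  exact ModuleCat.isZero_of_subsingleton _

/-- The projection of a trivial bundle to its base. -/
def univFst (X E : Type) [TopologicalSpace X] [TopologicalSpace E] :
    C((Set.univ : Set (X × E)), X) := ⟨fun p => p.1.1, by fun_prop⟩

lemma hasThomIso_zero [Subsingleton E] : HasThomIso E 0 := by
  refine ⟨fun X Y _ _ f k => ?_, fun X _ k hk => absurd hk k.not_lt_zero⟩
  have hempty (X : Type) [TopologicalSpace X] : IsEmpty (offZero E X) :=
    ⟨fun p => p.2 (Subsingleton.elim _ _)⟩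
  have key (X : Type) [TopologicalSpace X] : QuasiIso (pairSeq.obj (thomPair E X)).g := by
    have hS := @pairSeq_shortExact (thomPair E X) (inferInstanceAs (Mono (incl _)))
    have hz (k) : IsZero ((pairSeq.obj (thomPair E X)).X₁.homology k) := by
      have := hempty X
      exact (HomologicalComplex.homologyFunctor _ _ k).map_isZero
        (isZero_of_isEmpty (TopCat.of (offZero E X)))
    rw [quasiIso_iff]
    intro k
    rw [quasiIsoAt_iff_isIso_homologyMap]
    have h1 := (hS.homology_exact₂ k).mono_g ((hz k).eq_of_src _ _)
    have h2 : Epi (HomologicalComplex.homologyMap (pairSeq.obj (thomPair E X)).g k) := by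
      cases k with
      | zero =>
        have := hS.epi_g
        exact HomologicalComplex.epi_homologyMap_of_epi_of_not_rel _ _ (by simp)
      | succ k => exact (hS.homology_exact₃ (k + 1) k rfl).epi_f ((hz k).eq_of_tgt _ _)
    exact isIso_of_mono_of_epi _
  have key' (X : Type) [TopologicalSpace X] : QuasiIso (singularChains.map (TopCat.ofHom
      (univFst X E))) :=
    quasiIso_of_homotopyInverse _ ⟨fun x => ⟨(x, 0), trivial⟩, by fun_prop⟩
      (by
        convert ContinuousMap.Homotopic.refl _ using 1
        ext p
        · rfl
        · exact Subsingleton.elim _ _)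
      (ContinuousMap.Homotopic.refl _)
  have a1 : Nonempty (Arrow.mk (HomologicalComplex.homologyMap (pairSeq.map (thomMap E f)).τ₂ k) ≅
      Arrow.mk (HomologicalComplex.homologyMap (pairSeq.map (thomMap E f)).τ₃ k)) := by
    have := key X
    have := key Y
    exact ⟨Arrow.isoMk (asIso (HomologicalComplex.homologyMap (pairSeq.obj (thomPair E X)).g k))
      (asIso (HomologicalComplex.homologyMap (pairSeq.obj (thomPair E Y)).g k))
      (by
        simp only [asIso_hom, Arrow.mk_hom]
        rw [← HomologicalComplex.homologyMap_comp, ← HomologicalComplex.homologyMap_comp,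
          (pairSeq.map (thomMap E f)).comm₂₃])⟩
  have a2 : Nonempty (Arrow.mk (HomologicalComplex.homologyMap (pairSeq.map (thomMap E f)).τ₂ k) ≅
      Arrow.mk (HomologicalComplex.homologyMap (singularChains.map (TopCat.ofHom f)) k)) := by
    have h1 := isIso_homologyMap (key' X) k
    have h2 := isIso_homologyMap (key' Y) k
    refine ⟨Arrow.isoMk (@asIso _ _ _ _ _ h1) (@asIso _ _ _ _ _ h2) ?_⟩
    refine (HomologicalComplex.homologyMap_comp _ _ _).symm.trans
      (Eq.trans ?_ (HomologicalComplex.homologyMap_comp _ _ _))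
    have e : TopCat.ofHom (univFst X E) ≫ TopCat.ofHom f =
      (thomMap E f).right ≫ TopCat.ofHom (univFst Y E) := rfl
    have e' := (singularChains.map_comp _ _).symm.trans
      ((congrArg singularChains.map e).trans (singularChains.map_comp _ _))
    exact congrArg (HomologicalComplex.homologyMap · k) e'
  obtain ⟨a1⟩ := a1
  obtain ⟨a2⟩ := a2
  exact ⟨a1.symm ≪≫ a2⟩

end Thom

end SingChain

namespace SingChain

open Limits

section Excision

variable {X : Type} [TopologicalSpace X]

lemma isOpenEmbedding_incl {A B : Set X} (h : A ⊆ B) (hA : IsOpen A) :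
    Topology.IsOpenEmbedding (incl h) :=
  ⟨Topology.IsEmbedding.inclusion h, by
    have : Set.range (incl h) = Subtype.val ⁻¹' A := by
      ext x
      exact ⟨fun ⟨y, hy⟩ => hy ▸ y.2, fun hx => ⟨⟨x.1, hx⟩, rfl⟩⟩
    rw [this]
    exact hA.preimage continuous_subtype_val⟩

lemma quasiIso_excision_incl {I U V P : Set X} (hIV : I ⊆ V) (hUP : U ⊆ P) (hIU : I ⊆ U)
    (hVP : V ⊆ P) (hU : IsOpen U) (hV : IsOpen V) (hP : P ⊆ U ∪ V) (hI : U ∩ V ⊆ I) :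
    QuasiIso (relF.map (pairMap (ContinuousMap.id X) hIU hVP :
      Arrow.mk (incl hIV) ⟶ Arrow.mk (incl hUP))) := by
  refine quasiIso_excision (incl hIV) (incl hIU) (incl hVP) (incl hUP) rfl
    (isOpenEmbedding_incl _ hU) (isOpenEmbedding_incl _ hV) ?_ (Topology.IsEmbedding.inclusion hIV) ?_
  · refine Set.eq_univ_of_forall fun x => ?_
    rcases hP x.2 with h | h
    · exact Or.inl ⟨⟨x.1, h⟩, rfl⟩
    · exact Or.inr ⟨⟨x.1, h⟩, rfl⟩
  · ext x
    constructor
    · rintro ⟨y, rfl⟩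
      exact ⟨⟨y.1, hIU y.2⟩, rfl⟩
    · rintro ⟨y, hy⟩
      have : x.1 ∈ U := by
        have := congrArg Subtype.val hy
        exact this ▸ y.2
      exact ⟨⟨x.1, hI ⟨this, x.2⟩⟩, rfl⟩

end Excision

section Suspension

variable (E X : Type) {Y : Type} [NormedAddCommGroup E] [NormedSpace ℝ E]
  [TopologicalSpace X] [TopologicalSpace Y]

/-- The complement of the closed lower ray. -/
def offLower : Set (X × (E × ℝ)) := {p | p.2.1 ≠ 0 ∨ 0 < p.2.2}

/-- The complement of the closed upper ray. -/
def offUpper : Set (X × (E × ℝ)) := {p | p.2.1 ≠ 0 ∨ p.2.2 < 0}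

/-- The complement of the vertical axis. -/
def offAxis : Set (X × (E × ℝ)) := {p | p.2.1 ≠ 0}

lemma offLower_subset : offLower E X ⊆ offZero (E × ℝ) X := by
  rintro p hp h
  rcases hp with hp | hp
  · exact hp (by rw [h]; rfl)
  · exact hp.ne' (by rw [h]; rfl)

lemma offUpper_subset : offUpper E X ⊆ offZero (E × ℝ) X := by
  rintro p hp h
  rcases hp with hp | hp
  · exact hp (by rw [h]; rfl)
  · exact hp.ne (by rw [h]; rfl)

lemma offAxis_subset : offAxis E X ⊆ offUpper E X := fun _ h => Or.inl h

lemma offAxis_subset' : offAxis E X ⊆ offLower E X := fun _ h => Or.inl h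

lemma isOpen_offLower : IsOpen (offLower E X) :=
  (isOpen_ne.preimage (by fun_prop : Continuous fun p : X × (E × ℝ) => p.2.1)).union
    (isOpen_lt continuous_const (continuous_snd.comp continuous_snd))

lemma isOpen_offUpper : IsOpen (offUpper E X) :=
  (isOpen_ne.preimage (by fun_prop : Continuous fun p : X × (E × ℝ) => p.2.1)).union
    (isOpen_lt (continuous_snd.comp continuous_snd) continuous_const)

/-- The punctured bundle relative to the complement of the closed lower ray. -/
def lowerPair : Arrow TopCat.{0} := Arrow.mk (incl (offLower_subset E X))

/-- The complement of the closed upper ray relative to the complement of the vertical axis. -/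
def axisPair : Arrow TopCat.{0} := Arrow.mk (incl (offAxis_subset E X))

/-- The excision map. -/
def axisToLower : axisPair E X ⟶ lowerPair E X :=
  pairMap (ContinuousMap.id _) (offAxis_subset' E X) (offUpper_subset E X)

/-- The projection killing the last coordinate of the fibre. -/
def dropLast : C(X × (E × ℝ), X × E) := ⟨fun p => (p.1, p.2.1), by fun_prop⟩

/-- The projection away from the vertical axis. -/
def axisToThom : axisPair E X ⟶ thomPair E X :=
  pairMap (dropLast E X) (fun _ h => h) (fun _ _ => trivial)

lemma quasiIso_axisToLower : QuasiIso (relF.map (axisToLower E X)) := by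
  refine quasiIso_excision_incl _ _ _ _ (isOpen_offLower E X) (isOpen_offUpper E X) ?_ ?_
  · intro p hp
    by_contra! h
    have h1 : ¬(p.2.1 ≠ 0 ∨ 0 < p.2.2) := fun h' => h (Or.inl h')
    have h2 : ¬(p.2.1 ≠ 0 ∨ p.2.2 < 0) := fun h' => h (Or.inr h')
    push Not at h1 h2
    exact hp (Prod.ext h1.1 (le_antisymm h1.2 h2.2))
  · rintro p ⟨h1 | h1, h2 | h2⟩
    exacts [h1, h1, h2, absurd h1 h2.not_gt]

lemma quasiIso_axisToThom : QuasiIso (relF.map (axisToThom E X)) := by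
  have aux (A : Set (X × (E × ℝ))) (B : Set (X × E)) (hA : ∀ p ∈ A, (p.1, p.2.1) ∈ B)
      (hB : ∀ p ∈ B, (p.1, (p.2, (-1 : ℝ))) ∈ A)
      (hF : ∀ t : unitInterval, ∀ p ∈ A, (p.1, (p.2.1, -(1 - (t : ℝ)) + t * p.2.2)) ∈ A) :
      QuasiIso (singularChains.map (TopCat.ofHom (restr
        (dropLast E X) (A := A) (B := B) hA))) :=
    quasiIso_restr (A := A) (B := B) (dropLast E X)
      ⟨fun p => (p.1, (p.2, (-1 : ℝ))), by fun_prop⟩ hA hB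
      ⟨fun q => (q.2.1, (q.2.2.1, -(1 - (q.1 : ℝ)) + q.1 * q.2.2.2)), by fun_prop⟩
      ⟨Prod.snd, continuous_snd⟩ hF (fun _ _ h => h)
      (fun p _ => by simp [dropLast]) (fun p _ => by simp) (fun p _ => rfl) (fun p _ => rfl)
  refine @quasiIso_relF _ _ (inferInstanceAs (Mono (incl _))) (inferInstanceAs (Mono (incl _))) _
    (aux _ _ _ (fun _ h => h) fun _ _ h => h)
    (aux _ _ _ (fun _ _ => Or.inr (by norm_num)) ?_)
  rintro t p (h | h)
  · exact Or.inl h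
  · right
    have h0 := t.2.1
    have h1 := t.2.2
    change -(1 - (t : ℝ)) + t * p.2.2 < 0
    rcases h1.lt_or_eq with h1 | h1
    · nlinarith
    · rw [h1]; linarith

lemma quasiIso_offLower :
    QuasiIso (singularChains.map (incl (Set.subset_univ (offLower E X)))) := by
  refine quasiIso_restr (ContinuousMap.id _) ⟨fun p => (p.1, ((0 : E), (1 : ℝ))), by fun_prop⟩
    (A := offLower E X) (B := Set.univ) (fun _ _ => trivial) (fun _ _ => Or.inr one_pos)
    ⟨fun q => (q.2.1, ((q.1 : ℝ) • q.2.2.1, (1 - (q.1 : ℝ)) + q.1 * q.2.2.2)), by fun_prop⟩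
    ⟨fun q => (q.2.1, ((q.1 : ℝ) • q.2.2.1, (1 - (q.1 : ℝ)) + q.1 * q.2.2.2)), by fun_prop⟩
    ?_ (fun _ _ _ => trivial) (fun _ _ => by simp) (fun _ _ => by simp)
    (fun _ _ => by simp) (fun _ _ => by simp)
  rintro t p hp
  have h0 := t.2.1
  have h1 := t.2.2
  change ((t : ℝ) • p.2.1 ≠ 0) ∨ 0 < (1 - (t : ℝ)) + t * p.2.2
  rcases hp with h | h
  · rcases h0.eq_or_lt with h2 | h2
    · right; rw [← h2]; norm_num
    · left; exact smul_ne_zero h2.ne' h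
  · right
    rcases h1.lt_or_eq with h1 | h1
    · nlinarith
    · rw [h1]; linarith

/-- The triple used for the suspension isomorphism. -/
noncomputable def thomTriple : ShortComplex (ChainComplex (ModuleCat ℤ) ℕ) :=
  tripleSeq (incl (offLower_subset E X)) (incl (Set.subset_univ (offZero (E × ℝ) X)))

lemma thomTriple_shortExact : (thomTriple E X).ShortExact := tripleSeq_shortExact _ _

lemma isZero_thomTriple (k : ℕ) : IsZero ((thomTriple E X).X₂.homology k) := by
  have := acyclic_relF (Arrow.mk (incl (Set.subset_univ (offLower E X)))) (quasiIso_offLower E X)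
  exact (this k).isZero_homology

variable {X}

/-- The map of lower pairs induced by a map of the bases. -/
def lowerMap (f : C(X, Y)) : lowerPair E X ⟶ lowerPair E Y :=
  pairMap (f.prodMap (ContinuousMap.id _)) (fun _ h => h) (fun _ h => h)

/-- The map of axis pairs induced by a map of the bases. -/
def axisMap (f : C(X, Y)) : axisPair E X ⟶ axisPair E Y :=
  pairMap (f.prodMap (ContinuousMap.id _)) (fun _ h => h) (fun _ h => h)

/-- The map of triples induced by a map of the bases. -/
noncomputable def thomTripleMap (f : C(X, Y)) : thomTriple E X ⟶ thomTriple E Y :=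
  tripleMap (lowerMap E f).left (lowerMap E f).right (thomMap (E × ℝ) f).right rfl rfl

lemma thom_suspension (f : C(X, Y)) (k : ℕ) :
    Nonempty (Arrow.mk (HomologicalComplex.homologyMap (relF.map (thomMap (E × ℝ) f)) (k + 1)) ≅
      Arrow.mk (HomologicalComplex.homologyMap (relF.map (thomMap E f)) k)) := by
  obtain ⟨i₁⟩ := nonempty_arrowIso_of_quasiIso (axisMap E f) (lowerMap E f) (axisToLower E X)
    (axisToLower E Y) (pairMap_comp_pairMap _ _ _ _ _ _ _ _ _ _ _ _ fun _ _ => rfl)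
    (quasiIso_axisToLower E X) (quasiIso_axisToLower E Y) k
  obtain ⟨i₂⟩ := nonempty_arrowIso_of_quasiIso (axisMap E f) (thomMap E f) (axisToThom E X)
    (axisToThom E Y) (pairMap_comp_pairMap _ _ _ _ _ _ _ _ _ _ _ _ fun _ _ => rfl)
    (quasiIso_axisToThom E X) (quasiIso_axisToThom E Y) k
  have i₃ : Arrow.mk (HomologicalComplex.homologyMap (thomTripleMap E f).τ₃ (k + 1)) ≅
      Arrow.mk (HomologicalComplex.homologyMap (thomTripleMap E f).τ₁ k) :=
    Arrow.isoMk
      ((thomTriple_shortExact E X).δIso (k + 1) k rfl (isZero_thomTriple _ _ _)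
        (isZero_thomTriple _ _ _))
      ((thomTriple_shortExact E Y).δIso (k + 1) k rfl (isZero_thomTriple _ _ _)
        (isZero_thomTriple _ _ _))
      (HomologicalComplex.HomologySequence.δ_naturality (thomTripleMap E f)
        (thomTriple_shortExact E X) (thomTriple_shortExact E Y) (k + 1) k rfl)
  exact ⟨i₃ ≪≫ i₁.symm ≪≫ i₂⟩

variable {E}

lemma HasThomIso.prod_real {n : ℕ} (h : HasThomIso E n) : HasThomIso (E × ℝ) (n + 1) := by
  refine ⟨fun X Y _ _ f k => ?_, fun X _ k hk => ?_⟩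
  · obtain ⟨i⟩ := thom_suspension E f (k + n)
    obtain ⟨j⟩ := h.1 X Y f k
    exact ⟨i ≪≫ j⟩
  · cases k with
    | zero =>
      have := (thomTriple_shortExact E X).epi_g
      have h0 : Epi (HomologicalComplex.homologyMap (thomTriple E X).g 0) :=
        HomologicalComplex.epi_homologyMap_of_epi_of_not_rel _ _ (by simp)
      exact @IsZero.of_epi _ _ _ _ _ _ h0 (isZero_thomTriple E X 0)
    | succ k =>
      obtain ⟨i⟩ := thom_suspension E (ContinuousMap.id X) k
      exact (h.2 X k (by omega)).of_iso (Arrow.leftFunc.mapIso i)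

theorem hasThomIso_euclidean (N : ℕ) : HasThomIso (EuclideanSpace ℝ (Fin N)) N := by
  have h : HasThomIso (Fin N → ℝ) N := by
    induction N with
    | zero => exact hasThomIso_zero
    | succ n ih =>
      exact ih.prod_real.congr ((ContinuousLinearEquiv.prodComm ℝ _ _).trans
        (Fin.consEquivL ℝ fun _ => ℝ))
  exact h.congr (EuclideanSpace.equiv (Fin N) ℝ).symm

end Suspension

end SingChain

/-! ### Deletion and contraction -/

namespace ChromConf

open SingChain

section Graph

variable {V : Type} (G : SimpleGraph V) (i j : V)

/-- The deletion of an edge. -/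
def del : SimpleGraph V := G.deleteEdges {s(i, j)}

/-- The contraction of the edge `ij`, on the vertices other than `j`. -/
def contr : SimpleGraph {v : V // v ≠ j} where
  Adj u v := u ≠ v ∧ (G.Adj u v ∨ (u.1 = i ∧ G.Adj j v) ∨ (v.1 = i ∧ G.Adj j u))
  symm := ⟨fun _ _ h => ⟨h.1.symm, h.2.imp SimpleGraph.Adj.symm Or.symm⟩⟩
  loopless := ⟨fun _ h => h.1 rfl⟩

variable {G i j}

lemma del_adj {u v : V} : (del G i j).Adj u v ↔ G.Adj u v ∧ s(u, v) ≠ s(i, j) := by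
  simp [del]

lemma del_le : del G i j ≤ G := SimpleGraph.deleteEdges_le _

lemma del_mono {G' : SimpleGraph V} (h : G ≤ G') : del G i j ≤ del G' i j := fun _ _ huv =>
  del_adj.2 ⟨h (del_adj.1 huv).1, (del_adj.1 huv).2⟩

lemma contr_mono {G' : SimpleGraph V} (h : G ≤ G') : contr G i j ≤ contr G' i j := fun _ _ huv =>
  ⟨huv.1, huv.2.imp (fun h' => h h') (Or.imp (And.imp_right fun h' => h h')
    (And.imp_right fun h' => h h'))⟩

end Graph

section Spaces

variable (E : Type) [NormedAddCommGroup E] [NormedSpace ℝ E] {V : Type}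
  (G : SimpleGraph V) (i j : V)

/-- The chromatic configuration space of a graph. -/
def conf : Set (V → E) := {x | ∀ u v, G.Adj u v → x u ≠ x v}

variable {G i j} in
lemma conf_anti {G' : SimpleGraph V} (h : G ≤ G') : conf E G' ⊆ conf E G :=
  fun _ hx u v huv => hx u v (h huv)

variable {G i j} in
lemma mem_conf_iff (h : G.Adj i j) (x : V → E) :
    x ∈ conf E G ↔ x ∈ conf E (del G i j) ∧ x i ≠ x j := by
  refine ⟨fun hx => ⟨conf_anti E del_le hx, hx i j h⟩, fun ⟨hx, hij⟩ u v huv => ?_⟩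
  by_cases h' : s(u, v) = s(i, j)
  · rcases Sym2.eq_iff.1 h' with ⟨rfl, rfl⟩ | ⟨rfl, rfl⟩
    exacts [hij, hij.symm]
  · exact hx u v (del_adj.2 ⟨huv, h'⟩)

/-- The pair formed by the configuration spaces of a graph and of an edge deletion. -/
def confPair : Arrow TopCat.{0} := Arrow.mk (incl (conf_anti E (del_le (G := G) (i := i) (j := j))))

/-- The tuples for which no neighbour of `j` separates the points of `i` and `j`. -/
def tube : Set (V → E) := {x | (∀ u v, u ≠ j → v ≠ j → G.Adj u v → x u ≠ x v) ∧
  ∀ k, G.Adj j k → k ≠ i → ‖x i - x j‖ < ‖x i - x k‖ + ‖x k - x j‖}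

/-- The tuples of the tube with distinct points for `i` and `j`. -/
def tubeOff : Set (tube E G i j) := {x | x.1 i ≠ x.1 j}

/-- The tube as a pair. -/
def tubePair : Arrow TopCat.{0} := Arrow.mk (incl (Set.subset_univ (tubeOff E G i j)))

variable {E G i j}

lemma tube_ne {x : V → E} (hx : x ∈ tube E G i j) {k : V} (hk : G.Adj j k) (hki : k ≠ i) :
    x i ≠ x k ∧ x j ≠ x k := by
  have := hx.2 k hk hki
  constructor <;> intro h <;> simp [h] at this

lemma tube_subset : tube E G i j ⊆ conf E (del G i j) := by
  intro x hx u v huv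
  obtain ⟨hadj, hne⟩ := del_adj.1 huv
  by_cases hu : u = j
  · subst hu
    exact (tube_ne hx hadj (by rintro rfl; exact hne Sym2.eq_swap)).2
  by_cases hv : v = j
  · subst hv
    exact (tube_ne hx hadj.symm (by rintro rfl; exact hne rfl)).2.symm
  exact hx.1 u v hu hv hadj

lemma tubeOff_subset (h : G.Adj i j) (x : tubeOff E G i j) : x.1.1 ∈ conf E G :=
  (mem_conf_iff E h _).2 ⟨tube_subset x.1.2, x.2⟩

lemma conf_del_subset (h : G.Adj i j) : conf E (del G i j) ⊆ conf E G ∪ tube E G i j := by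
  intro x hx
  by_cases hij : x i = x j
  · refine Or.inr ⟨fun u v hu hv huv => hx u v (del_adj.2 ⟨huv, fun he => ?_⟩), fun k hk hki => ?_⟩
    · rcases Sym2.eq_iff.1 he with ⟨_, h⟩ | ⟨h, _⟩
      exacts [hv h, hu h]
    · have : x j ≠ x k := hx j k (del_adj.2 ⟨hk, fun he => by
        rcases Sym2.eq_iff.1 he with ⟨h', _⟩ | ⟨_, h'⟩
        exacts [h.ne h'.symm, hki h']⟩)
      rw [hij, sub_self, norm_zero]
      have := norm_pos_iff.2 (sub_ne_zero.2 this)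
      positivity
  · exact Or.inl ((mem_conf_iff E h x).2 ⟨hx, hij⟩)

lemma isOpen_conf [Finite V] : IsOpen (conf E G) := by
  simp only [conf, Set.ofPred_forall]
  exact isOpen_iInter_of_finite fun u => isOpen_iInter_of_finite fun v =>
    isOpen_iInter_of_finite fun _ => isOpen_ne_fun (by fun_prop) (by fun_prop)

lemma isOpen_tube [Finite V] : IsOpen (tube E G i j) := by
  simp only [tube, Set.ofPred_and, Set.ofPred_forall]
  refine IsOpen.inter ?_ ?_
  · exact isOpen_iInter_of_finite fun u => isOpen_iInter_of_finite fun v =>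
      isOpen_iInter_of_finite fun _ => isOpen_iInter_of_finite fun _ =>
      isOpen_iInter_of_finite fun _ => isOpen_ne_fun (by fun_prop) (by fun_prop)
  · exact isOpen_iInter_of_finite fun k => isOpen_iInter_of_finite fun _ =>
      isOpen_iInter_of_finite fun _ => isOpen_lt (by fun_prop) (by fun_prop)

/-- The inclusion of the tube with distinct points into the configuration space. -/
def tubeLeft (h : G.Adj i j) : C(tubeOff E G i j, conf E G) :=
  ⟨fun x => ⟨x.1.1, tubeOff_subset h x⟩, by fun_prop⟩

variable (E G i j) in
/-- The inclusion of the tube into the configuration space of the deletion. -/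
def tubeRight : C((Set.univ : Set (tube E G i j)), conf E (del G i j)) :=
  ⟨fun x => ⟨x.1.1, tube_subset x.1.2⟩, by fun_prop⟩

/-- The inclusion of the tube. -/
def tubeToConf (h : G.Adj i j) : tubePair E G i j ⟶ confPair E G i j :=
  Arrow.homMk (TopCat.ofHom (tubeLeft h)) (TopCat.ofHom (tubeRight E G i j)) rfl

lemma isOpenEmbedding_tubeRight [Finite V] : Topology.IsOpenEmbedding (tubeRight E G i j) := by
  refine ⟨Topology.IsEmbedding.of_comp (g := Subtype.val) (by fun_prop) (by fun_prop)
    ((Topology.IsEmbedding.subtypeVal (X := V → E) (p := (· ∈ tube E G i j))).comp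
      Topology.IsEmbedding.subtypeVal), ?_⟩
  have : Set.range (tubeRight E G i j) = Subtype.val ⁻¹' (tube E G i j) := by
    ext x
    exact ⟨fun ⟨y, hy⟩ => hy ▸ y.1.2, fun hx => ⟨⟨⟨x.1, hx⟩, trivial⟩, rfl⟩⟩
  rw [this]
  exact isOpen_tube.preimage continuous_subtype_val

lemma quasiIso_tubeToConf [Finite V] (h : G.Adj i j) :
    QuasiIso (relF.map (tubeToConf (E := E) h)) := by
  refine quasiIso_excision (incl (Set.subset_univ (tubeOff E G i j)))
    (TopCat.ofHom (tubeLeft h)) (TopCat.ofHom (tubeRight E G i j))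
    (incl (conf_anti E del_le)) rfl (isOpenEmbedding_incl _ isOpen_conf)
    isOpenEmbedding_tubeRight ?_
    (Topology.IsEmbedding.inclusion (Set.subset_univ (tubeOff E G i j))) ?_
  · refine Set.eq_univ_of_forall fun x => ?_
    rcases conf_del_subset h x.2 with h | h
    · exact Or.inl ⟨⟨x.1, h⟩, rfl⟩
    · exact Or.inr ⟨⟨⟨x.1, h⟩, trivial⟩, rfl⟩
  · ext x
    constructor
    · rintro ⟨y, rfl⟩
      exact ⟨⟨y.1.1, tubeOff_subset h y⟩, rfl⟩
    · rintro ⟨y, hy⟩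
      have : x.1.1 i ≠ x.1.1 j := by
        have := congrArg Subtype.val hy
        have hy' := y.2 i j h
        exact this ▸ hy'
      exact ⟨⟨x.1, this⟩, rfl⟩

lemma tube_restrict {x : V → E} (hx : x ∈ tube E G i j) :
    (fun k : {v : V // v ≠ j} => x k) ∈ conf E (contr G i j) := by
  rintro u v ⟨hne, h | ⟨rfl, h⟩ | ⟨rfl, h⟩⟩
  · exact hx.1 _ _ u.2 v.2 h
  · exact (tube_ne hx h fun h => hne (Subtype.ext h.symm)).1
  · exact (tube_ne hx h fun h => hne (Subtype.ext h)).1.symm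

variable (E G i j) in
/-- The projection of the tube to a trivial bundle over the contraction. -/
def tubeProj : C(tube E G i j, conf E (contr G i j) × E) :=
  ⟨fun x => (⟨fun k => x.1 k, tube_restrict x.2⟩, x.1 j - x.1 i),
    Continuous.prodMk (Continuous.subtype_mk (continuous_pi fun k =>
      (continuous_apply k.1).comp continuous_subtype_val) _)
      (((continuous_apply j).comp continuous_subtype_val).sub
        ((continuous_apply i).comp continuous_subtype_val))⟩

variable (E G i j) in
/-- The projection of the tube as a map of pairs. -/
def tubeToThom : tubePair E G i j ⟶ thomPair E (conf E (contr G i j)) :=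
  pairMap (tubeProj E G i j) (fun _ hx => sub_ne_zero.2 (Ne.symm hx)) (fun _ _ => trivial)

end Spaces

end ChromConf

namespace ChromConf

open SingChain

section Contraction

variable {E : Type} [NormedAddCommGroup E] [NormedSpace ℝ E] {V : Type} [Fintype V]
  {G : SimpleGraph V} {i j : V}

open Classical in
/-- A lower bound for the distances of the point of `i` from the points of the neighbours of `j`. -/
noncomputable def gap (G : SimpleGraph V) (i j : V) (x : V → E) : ℝ :=
  ∏ k : V, if G.Adj j k ∧ k ≠ i then min 1 ‖x i - x k‖ else 1

lemma continuous_gap : Continuous (gap (E := E) G i j) := by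
  refine continuous_finsetProd _ fun k _ => ?_
  split_ifs <;> fun_prop

lemma gap_le {x : V → E} {k : V} (hk : G.Adj j k) (hki : k ≠ i) : gap G i j x ≤ ‖x i - x k‖ := by
  classical
  rw [gap, ← Finset.mul_prod_erase _ _ (Finset.mem_univ k), if_pos ⟨hk, hki⟩]
  refine (mul_le_of_le_one_right (by positivity) (Finset.prod_le_one (fun l _ => ?_)
    fun l _ => ?_)).trans (min_le_right _ _)
  · split_ifs <;> positivity
  · split_ifs
    exacts [min_le_left _ _, le_rfl]

lemma gap_pos {x : V → E} (hx : ∀ k, G.Adj j k → k ≠ i → x i ≠ x k) : 0 < gap G i j x := by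
  classical
  refine Finset.prod_pos fun k _ => ?_
  split_ifs with h
  · exact lt_min one_pos (norm_pos_iff.2 (sub_ne_zero.2 (hx k h.1 h.2)))
  · exact one_pos

/-- The rate by which a displacement is scaled to be shorter than the gap. -/
noncomputable def rate (G : SimpleGraph V) (i j : V) (x : V → E) (v : E) : ℝ :=
  gap G i j x / (gap G i j x + ‖v‖)

lemma rate_pos {x : V → E} (hx : ∀ k, G.Adj j k → k ≠ i → x i ≠ x k) (v : E) :
    0 < rate G i j x v :=
  div_pos (gap_pos hx) (add_pos_of_pos_of_nonneg (gap_pos hx) (norm_nonneg _))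

lemma rate_le_one {x : V → E} (hx : ∀ k, G.Adj j k → k ≠ i → x i ≠ x k) (v : E) :
    rate G i j x v ≤ 1 :=
  div_le_one_of_le₀ (le_add_of_nonneg_right (norm_nonneg _))
    (add_pos_of_pos_of_nonneg (gap_pos hx) (norm_nonneg _)).le

lemma norm_rate_smul_lt {x : V → E} (hx : ∀ k, G.Adj j k → k ≠ i → x i ≠ x k) (v : E) :
    ‖rate G i j x v • v‖ < gap G i j x := by
  have h := gap_pos hx
  have h' : 0 < gap G i j x + ‖v‖ := add_pos_of_pos_of_nonneg h (norm_nonneg _)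
  rw [norm_smul, Real.norm_of_nonneg (rate_pos hx v).le, rate, div_mul_eq_mul_div,
    div_lt_iff₀ h']
  nlinarith

/-- Linear interpolation between `a` and `1`. -/
noncomputable def interp (t : unitInterval) (a : ℝ) : ℝ := (1 - (t : ℝ)) * a + t

lemma interp_zero (a : ℝ) : interp 0 a = a := by simp [interp]

lemma interp_one (a : ℝ) : interp 1 a = 1 := by simp [interp]

lemma interp_pos (t : unitInterval) {a : ℝ} (ha : 0 < a) : 0 < interp t a := by
  have h0 := t.2.1
  have h1 := t.2.2
  rw [interp]
  rcases h0.eq_or_lt with h | h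
  · rw [← h]; simpa
  · have := mul_nonneg (sub_nonneg.2 h1) ha.le
    linarith

lemma interp_le_one (t : unitInterval) {a : ℝ} (ha : a ≤ 1) : interp t a ≤ 1 := by
  have h1 := t.2.2
  rw [interp]
  nlinarith

open Classical in
/-- The extension of a tuple on the contraction by a point at a given displacement from `i`. -/
noncomputable def extend (hij : i ≠ j) (y : {v : V // v ≠ j} → E) (v : E) : V → E :=
  fun k => if h : k = j then y ⟨i, hij⟩ + v else y ⟨k, h⟩

lemma extend_self (hij : i ≠ j) (y : {v : V // v ≠ j} → E) (v : E) :
    extend hij y v j = y ⟨i, hij⟩ + v := by simp [extend]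

lemma extend_of_ne (hij : i ≠ j) (y : {v : V // v ≠ j} → E) (v : E) {k : V} (h : k ≠ j) :
    extend hij y v k = y ⟨k, h⟩ := by simp [extend, h]

lemma continuous_extend (hij : i ≠ j) :
    Continuous fun p : ({v : V // v ≠ j} → E) × E => extend hij p.1 p.2 := by
  refine continuous_pi fun k => ?_
  by_cases h : k = j
  · subst h
    simp only [extend_self]
    fun_prop
  · simp only [extend_of_ne hij _ _ h]
    fun_prop

lemma extend_mem_tube (hij : i ≠ j) {y : {v : V // v ≠ j} → E} (hy : y ∈ conf E (contr G i j))
    {v : E} (hv : ∀ k (hk : k ≠ j), G.Adj j k → k ≠ i → ‖v‖ < ‖y ⟨i, hij⟩ - y ⟨k, hk⟩‖) :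
    extend hij y v ∈ tube E G i j := by
  refine ⟨fun u v hu hv huv => ?_, fun k hk hki => ?_⟩
  · rw [extend_of_ne hij _ _ hu, extend_of_ne hij _ _ hv]
    exact hy _ _ ⟨fun h => huv.ne (congrArg Subtype.val h), Or.inl huv⟩
  · rw [extend_self, extend_of_ne hij _ _ hij, extend_of_ne hij _ _ hk.ne']
    have := hv k hk.ne' hk hki
    have h2 := norm_nonneg (y ⟨k, hk.ne'⟩ - (y ⟨i, hij⟩ + v))
    rw [sub_add_cancel_left, norm_neg]
    linarith

lemma ne_of_mem_conf_contr (hij : i ≠ j) {y : {v : V // v ≠ j} → E}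
    (hy : y ∈ conf E (contr G i j)) (w : E) (k : V) (hk : G.Adj j k) (hki : k ≠ i) :
    extend hij y w i ≠ extend hij y w k := by
  rw [extend_of_ne hij _ _ hij, extend_of_ne hij _ _ hk.ne']
  exact hy _ _ ⟨fun h => hki (congrArg Subtype.val h).symm, Or.inr (Or.inl ⟨rfl, hk⟩)⟩

lemma continuous_rate {Z : Type} [TopologicalSpace Z] {f : Z → V → E} {g : Z → E}
    (hf : Continuous f) (hg : Continuous g)
    (h : ∀ z k, G.Adj j k → k ≠ i → f z i ≠ f z k) : Continuous fun z => rate G i j (f z) (g z) :=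
  (continuous_gap.comp hf).div ((continuous_gap.comp hf).add hg.norm) fun z =>
    (add_pos_of_pos_of_nonneg (gap_pos (h z)) (norm_nonneg _)).ne'

/-- The displacement of an element of the trivial bundle, scaled to fit in the tube. -/
noncomputable def shrink (G : SimpleGraph V) (hij : i ≠ j) (y : {v : V // v ≠ j} → E) (v : E) : ℝ :=
  rate G i j (extend hij y 0) v

lemma continuous_shrink (hij : i ≠ j) :
    Continuous fun p : conf E (contr G i j) × E => shrink G hij p.1.1 p.2 :=
  continuous_rate ((continuous_extend hij).comp (f := fun p : conf E (contr G i j) × E =>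
    (p.1.1, (0 : E))) (by fun_prop)) continuous_snd
    fun p => ne_of_mem_conf_contr hij p.1.2 0

/-- The section of the projection of the tube. -/
noncomputable def tubeSection (G : SimpleGraph V) (hij : i ≠ j) :
    C(conf E (contr G i j) × E, tube E G i j) :=
  ⟨fun p => ⟨extend hij p.1.1 (shrink G hij p.1.1 p.2 • p.2), extend_mem_tube hij p.1.2
    fun k hk hk' hki => (norm_rate_smul_lt (ne_of_mem_conf_contr hij p.1.2 0) p.2).trans_le (by
      have := gap_le (x := extend hij p.1.1 0) hk' hki
      rwa [extend_of_ne hij _ _ hij, extend_of_ne hij _ _ hk] at this)⟩,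
    Continuous.subtype_mk ((continuous_extend hij).comp (f := fun p : conf E (contr G i j) × E =>
      (p.1.1, shrink G hij p.1.1 p.2 • p.2)) ((by fun_prop : Continuous fun p :
      conf E (contr G i j) × E => p.1.1).prodMk ((continuous_shrink hij).smul continuous_snd))) _⟩

/-- Moving the point of `j` towards the point of `i`. -/
noncomputable def pull (hij : i ≠ j) (c : ℝ) (x : V → E) : V → E :=
  extend hij (fun k => x k) (c • (x j - x i))

lemma pull_one (hij : i ≠ j) (x : V → E) : pull hij 1 x = x := by
  ext k
  by_cases h : k = j
  · subst h; simp [pull, extend_self]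
  · simp [pull, extend_of_ne hij _ _ h]

lemma pull_mem_tube (hij : i ≠ j) {c : ℝ} (hc : 0 < c) (hc' : c ≤ 1) {x : V → E}
    (hx : x ∈ tube E G i j) : pull hij c x ∈ tube E G i j := by
  refine ⟨fun u v hu hv huv => ?_, fun k hk hki => ?_⟩
  · rw [pull, extend_of_ne hij _ _ hu, extend_of_ne hij _ _ hv]
    exact hx.1 u v hu hv huv
  · rw [pull, extend_self, extend_of_ne hij _ _ hij, extend_of_ne hij _ _ hk.ne']
    have h1 := hx.2 k hk hki
    have h2 : ‖x k - x j‖ ≤ ‖x k - (x i + c • (x j - x i))‖ + (1 - c) * ‖x i - x j‖ := by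
      rw [← Real.norm_of_nonneg (sub_nonneg.2 hc'), ← norm_smul]
      refine (norm_add_le _ _).trans_eq' ?_
      congr 1
      module
    have h3 : ‖x i - (x i + c • (x j - x i))‖ = c * ‖x i - x j‖ := by
      rw [sub_add_cancel_left, norm_neg, norm_smul, Real.norm_of_nonneg hc.le, norm_sub_rev]
    rw [h3]
    linarith

lemma pull_ne (hij : i ≠ j) {c : ℝ} (hc : 0 < c) {x : V → E} (hx : x i ≠ x j) :
    pull hij c x i ≠ pull hij c x j := by
  rw [pull, extend_self, extend_of_ne hij _ _ hij]
  intro h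
  rcases smul_eq_zero.1 (left_eq_add.1 h) with h | h
  exacts [hc.ne' h, hx (sub_eq_zero.1 h).symm]

lemma shrink_pos (hij : i ≠ j) {y : {v : V // v ≠ j} → E} (hy : y ∈ conf E (contr G i j)) (v : E) :
    0 < shrink G hij y v :=
  rate_pos (ne_of_mem_conf_contr hij hy 0) v

lemma shrink_le_one (hij : i ≠ j) {y : {v : V // v ≠ j} → E} (hy : y ∈ conf E (contr G i j))
    (v : E) : shrink G hij y v ≤ 1 :=
  rate_le_one (ne_of_mem_conf_contr hij hy 0) v

lemma continuous_interp {Z : Type} [TopologicalSpace Z] {f : Z → ℝ} (hf : Continuous f) :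
    Continuous fun p : unitInterval × Z => interp p.1 (f p.2) := by
  unfold interp
  fun_prop

/-- The fibrewise homotopy from the shrinking map to the identity. -/
noncomputable def bundleHomotopy (G : SimpleGraph V) (hij : i ≠ j) :
    C(unitInterval × (conf E (contr G i j) × E), conf E (contr G i j) × E) :=
  ⟨fun p => (p.2.1, interp p.1 (shrink G hij p.2.1.1 p.2.2) • p.2.2),
    (by fun_prop : Continuous fun p : unitInterval × (conf E (contr G i j) × E) => p.2.1).prodMk
      ((continuous_interp (continuous_shrink hij)).smul (by fun_prop))⟩

lemma continuous_pull (hij : i ≠ j) : Continuous fun p : ℝ × (V → E) => pull hij p.1 p.2 :=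
  (continuous_extend hij).comp (f := fun p : ℝ × (V → E) =>
    ((fun k : {v : V // v ≠ j} => p.2 k), p.1 • (p.2 j - p.2 i))) (by fun_prop)

/-- The homotopy from the shrinking map of the tube to the identity. -/
noncomputable def tubeHomotopy (G : SimpleGraph V) (hij : i ≠ j) :
    C(unitInterval × tube E G i j, tube E G i j) :=
  ⟨fun p => ⟨pull hij (interp p.1 (shrink G hij (tubeProj E G i j p.2).1.1
      (tubeProj E G i j p.2).2)) p.2.1, pull_mem_tube hij
        (interp_pos _ (shrink_pos hij (tube_restrict p.2.2) _))
        (interp_le_one _ (shrink_le_one hij (tube_restrict p.2.2) _)) p.2.2⟩,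
    Continuous.subtype_mk ((continuous_pull hij).comp
      ((continuous_interp ((continuous_shrink hij).comp (tubeProj E G i j).continuous)).prodMk
        (by fun_prop))) _⟩

lemma tubeSection_tubeProj (hij : i ≠ j) (x : tube E G i j) :
    tubeSection G hij (tubeProj E G i j x) = tubeHomotopy G hij (0, x) := by
  refine Subtype.ext ?_
  change _ = pull hij _ _
  rw [interp_zero]
  rfl

lemma tubeHomotopy_one (hij : i ≠ j) (x : tube E G i j) : tubeHomotopy G hij (1, x) = x := by
  refine Subtype.ext ?_
  change pull hij _ _ = _
  rw [interp_one, pull_one]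

lemma tubeProj_tubeSection (hij : i ≠ j) (p : conf E (contr G i j) × E) :
    tubeProj E G i j (tubeSection G hij p) = bundleHomotopy G hij (0, p) := by
  refine Prod.ext (Subtype.ext (funext fun k => ?_)) ?_
  · exact extend_of_ne hij _ _ k.2
  · change extend hij _ _ j - extend hij _ _ i = interp 0 _ • p.2
    rw [interp_zero, extend_self, extend_of_ne hij _ _ hij, add_sub_cancel_left]

lemma bundleHomotopy_one (hij : i ≠ j) (p : conf E (contr G i j) × E) :
    bundleHomotopy G hij (1, p) = p := by
  refine Prod.ext rfl ?_
  change interp 1 _ • p.2 = p.2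
  rw [interp_one, one_smul]

lemma quasiIso_tubeToThom (hij : i ≠ j) : QuasiIso (relF.map (tubeToThom E G i j)) := by
  have aux (A : Set (tube E G i j)) (B : Set (conf E (contr G i j) × E))
      (hA : Set.MapsTo (tubeProj E G i j) A B) (hB : Set.MapsTo (tubeSection G hij) B A)
      (hF : ∀ t, ∀ x ∈ A, tubeHomotopy G hij (t, x) ∈ A)
      (hG : ∀ t, ∀ p ∈ B, bundleHomotopy G hij (t, p) ∈ B) :
      QuasiIso (singularChains.map (TopCat.ofHom (restr (tubeProj E G i j) hA))) :=
    quasiIso_restr (tubeProj E G i j) (tubeSection G hij) hA hB (tubeHomotopy G hij)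
      (bundleHomotopy G hij) hF hG (fun x _ => (tubeSection_tubeProj hij x).symm)
      (fun x _ => tubeHomotopy_one hij x) (fun p _ => (tubeProj_tubeSection hij p).symm)
      (fun p _ => bundleHomotopy_one hij p)
  refine @quasiIso_relF _ _ (inferInstanceAs (Mono (incl _))) (inferInstanceAs (Mono (incl _))) _
    (aux _ _ _ ?_ ?_ ?_)
    (aux _ _ _ (fun _ _ => trivial) (fun _ _ _ => trivial) fun _ _ _ => trivial)
  · intro p hp h
    have h' : extend hij p.1.1 (shrink G hij p.1.1 p.2 • p.2) i =
      extend hij p.1.1 (shrink G hij p.1.1 p.2 • p.2) j := h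
    rw [extend_self, extend_of_ne hij _ _ hij] at h'
    exact smul_ne_zero (shrink_pos hij p.1.2 _).ne' hp (left_eq_add.1 h')
  · intro t x hx
    exact pull_ne hij (interp_pos _ (shrink_pos hij (tube_restrict x.2) _)) hx
  · intro t p hp
    exact smul_ne_zero (interp_pos _ (shrink_pos hij p.1.2 _)).ne' hp

end Contraction

section Naturality

variable (E : Type) [NormedAddCommGroup E] [NormedSpace ℝ E] {V : Type} [Fintype V]
  {G G' : SimpleGraph V} (i j : V)

/-- The inclusion of configuration spaces. -/
def confIncl (h : G ≤ G') : C(conf E G', conf E G) :=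
  ⟨Set.inclusion (conf_anti E h), continuous_inclusion _⟩

/-- The inclusion of pairs of configuration spaces. -/
def confPairMap (h : G ≤ G') : confPair E G' i j ⟶ confPair E G i j :=
  pairMap (ContinuousMap.id _) (conf_anti E h) (conf_anti E (del_mono h))

variable {E i j} in
lemma tube_anti (h : G ≤ G') : tube E G' i j ⊆ tube E G i j :=
  fun _ hx => ⟨fun u v hu hv huv => hx.1 u v hu hv (h huv), fun k hk hki => hx.2 k (h hk) hki⟩

/-- The inclusion of tubes as a map of pairs. -/
def tubePairMap (h : G ≤ G') : tubePair E G' i j ⟶ tubePair E G i j :=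
  pairMap ⟨Set.inclusion (tube_anti h), continuous_inclusion _⟩ (fun _ h => h) (fun _ _ => trivial)

variable {i j}

lemma confPair_thom (h : G ≤ G') (hij : G.Adj i j) (k : ℕ) :
    Nonempty (Arrow.mk (HomologicalComplex.homologyMap (relF.map (confPairMap E i j h)) k) ≅
      Arrow.mk (HomologicalComplex.homologyMap
        (relF.map (thomMap E (confIncl E (contr_mono (i := i) (j := j) h)))) k)) := by
  obtain ⟨i₁⟩ := nonempty_arrowIso_of_quasiIso (tubePairMap E i j h) (confPairMap E i j h)
    (tubeToConf (h hij)) (tubeToConf hij) (by ext <;> rfl) (quasiIso_tubeToConf _)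
    (quasiIso_tubeToConf _) k
  obtain ⟨i₂⟩ := nonempty_arrowIso_of_quasiIso (tubePairMap E i j h)
    (thomMap E (confIncl E (contr_mono (i := i) (j := j) h)))
    (tubeToThom E G' i j) (tubeToThom E G i j)
    (pairMap_comp_pairMap _ _ _ _ _ _ _ _ _ _ _ _ fun _ _ => rfl) (quasiIso_tubeToThom hij.ne)
    (quasiIso_tubeToThom hij.ne) k
  exact ⟨i₁.symm ≪≫ i₂⟩

end Naturality

end ChromConf

/-! ### Betti numbers -/

namespace SingChain

open Limits

/-- The singular chains of a point. -/
noncomputable def singularChainsPUnit : singularChains.obj (TopCat.of PUnit.{1}) ≅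
    ChainComplex.alternatingConst.obj ((ModuleCat.free ℤ).obj PUnit.{1}) :=
  (AlgebraicTopology.alternatingFaceMapComplex _).mapIso
    (((SimplicialObject.whiskering _ _).obj _).mapIso
    (TopCat.toSSetIsoConst (TopCat.of PUnit.{1})) ≪≫ Functor.constComp _ _ _) ≪≫
    AlgebraicTopology.alternatingFaceMapComplexConst.app _

lemma rank_homology_punit (k : ℕ) :
    Module.rank ℤ ((singularChains.obj (TopCat.of PUnit.{1})).homology k) =
      if k = 0 then 1 else 0 := by
  split_ifs with h
  · subst h
    let e := (HomologicalComplex.homologyFunctor (ModuleCat ℤ) _ 0).mapIso singularChainsPUnit ≪≫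
      ChainComplex.alternatingConstHomologyZero _
    refine e.toLinearEquiv.rank_eq.trans ?_
    exact (rank_finsupp_self' (R := ℤ) (ι := PUnit.{1})).trans (by simp)
  · have hz : IsZero ((singularChains.obj (TopCat.of PUnit.{1})).homology k) :=
      ((ChainComplex.alternatingConst_exactAt _ _ h).of_iso singularChainsPUnit.symm).isZero_homology
    have := ModuleCat.subsingleton_of_isZero hz
    exact rank_subsingleton' _ _

lemma quasiIso_const {X : Type} [TopologicalSpace X] [ContractibleSpace X] (x : X) :
    QuasiIso (singularChains.map (TopCat.ofHom (ContinuousMap.const PUnit.{1} x))) := by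
  refine quasiIso_of_homotopyInverse _ (ContinuousMap.const X PUnit.unit)
    (ContinuousMap.Homotopic.refl _) ?_
  obtain ⟨y, hy⟩ := id_nullhomotopic X
  refine ContinuousMap.Homotopic.trans ?_ hy.symm
  exact ContinuousMap.Homotopic.comp hy (ContinuousMap.Homotopic.refl (ContinuousMap.const X x))

lemma rank_homology_of_contractible (X : Type) [TopologicalSpace X] [ContractibleSpace X] (k : ℕ) :
    Module.rank ℤ ((singularChains.obj (TopCat.of X)).homology k) = if k = 0 then 1 else 0 := by
  obtain ⟨x⟩ : Nonempty X := inferInstance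
  have := isIso_homologyMap (quasiIso_const x) k
  rw [← rank_homology_punit k]
  exact (@asIso _ _ _ _ _ this).toLinearEquiv.rank_eq.symm

section Exact

lemma rank_eq_add_of_exact {R : Type} [CommRing R] [IsDomain R] {M₁ M₂ M₃ : Type}
    [AddCommGroup M₁] [AddCommGroup M₂] [AddCommGroup M₃] [Module R M₁] [Module R M₂] [Module R M₃]
    (d : M₃ →ₗ[R] M₁) (f : M₁ →ₗ[R] M₂) (hd : Function.Injective d) (hf : Function.Surjective f)
    (h : LinearMap.ker f = LinearMap.range d) :
    Module.rank R M₁ = Module.rank R M₂ + Module.rank R M₃ := by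
  rw [← LinearMap.rank_range_add_rank_ker f, h, rank_range_of_surjective _ hf,
    (LinearEquiv.ofInjective d hd).rank_eq]

variable {S S' : ShortComplex (ChainComplex (ModuleCat.{0} ℤ) ℕ)}

lemma rank_homology_eq_add (hS : S.ShortExact)
    (h : ∀ k, Function.Surjective (HomologicalComplex.homologyMap S.f k)) (k : ℕ) :
    Module.rank ℤ (S.X₁.homology k) =
      Module.rank ℤ (S.X₂.homology k) + Module.rank ℤ (S.X₃.homology (k + 1)) := by
  have hδ : Function.Injective (hS.δ (k + 1) k rfl) := by
    rw [← LinearMap.ker_eq_bot (f := (hS.δ (k + 1) k rfl).hom), LinearMap.ker_eq_bot']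
    intro z hz
    obtain ⟨y, rfl⟩ := (ShortComplex.moduleCat_exact_iff _).1
      (hS.homology_exact₃ (k + 1) k rfl) z hz
    obtain ⟨x, rfl⟩ := h _ y
    have := ConcreteCategory.congr_hom
      (HomologicalComplex.homologyMap_comp S.f S.g (k + 1)) x
    rw [S.zero, HomologicalComplex.homologyMap_zero] at this
    exact this.symm
  have hker : LinearMap.ker (HomologicalComplex.homologyMap S.f k).hom =
      LinearMap.range (hS.δ (k + 1) k rfl).hom :=
    ((ShortComplex.moduleCat_exact_iff_range_eq_ker _).1
      (hS.homology_exact₁ (k + 1) k rfl)).symm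
  exact rank_eq_add_of_exact _ _ hδ (h k) hker

lemma surjective_homologyMap_τ₁ (φ : S ⟶ S') (hS : S.ShortExact) (hS' : S'.ShortExact) (k : ℕ)
    (h₂ : ∀ x : S'.X₁.homology k, ∃ y : S.X₁.homology k,
      HomologicalComplex.homologyMap S'.f k (HomologicalComplex.homologyMap φ.τ₁ k y) =
        HomologicalComplex.homologyMap S'.f k x)
    (h₃ : Function.Surjective (HomologicalComplex.homologyMap φ.τ₃ (k + 1))) :
    Function.Surjective (HomologicalComplex.homologyMap φ.τ₁ k) := by
  intro a
  obtain ⟨b, hb⟩ := h₂ a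
  obtain ⟨c, hc⟩ := (ShortComplex.moduleCat_exact_iff _).1
    (hS'.homology_exact₁ (k + 1) k rfl) (a - HomologicalComplex.homologyMap φ.τ₁ k b)
    (by
      refine (map_sub (HomologicalComplex.homologyMap S'.f k).hom _ _).trans ?_
      exact sub_eq_zero.2 hb.symm)
  obtain ⟨c, rfl⟩ := h₃ c
  refine ⟨b + hS.δ (k + 1) k rfl c, ?_⟩
  have := ConcreteCategory.congr_hom
    (HomologicalComplex.HomologySequence.δ_naturality φ hS hS' (k + 1) k rfl) c
  rw [map_add]
  refine (congrArg _ (this.trans hc)).trans ?_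
  abel

end Exact

lemma surjective_of_arrowIso {A B A' B' : ModuleCat.{0} ℤ} {f : A ⟶ B} {g : A' ⟶ B'}
    (e : Arrow.mk f ≅ Arrow.mk g) (hg : Function.Surjective g) : Function.Surjective f := by
  rw [← ModuleCat.epi_iff_surjective] at hg ⊢
  exact ((MorphismProperty.epimorphisms _).arrow_mk_iso_iff e).2 hg

lemma HasThomIso.surjective {E : Type} [NormedAddCommGroup E] [NormedSpace ℝ E] {n : ℕ}
    (hE : HasThomIso E n) {X Y : Type} [TopologicalSpace X] [TopologicalSpace Y] (f : C(X, Y))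
    (hf : ∀ k, Function.Surjective
      (HomologicalComplex.homologyMap (singularChains.map (TopCat.ofHom f)) k)) (k : ℕ) :
    Function.Surjective (HomologicalComplex.homologyMap (relF.map (thomMap E f)) k) := by
  rcases lt_or_ge k n with h | h
  · have := ModuleCat.subsingleton_of_isZero (hE.2 Y k h)
    exact fun _ => ⟨0, Subsingleton.elim _ _⟩
  · obtain ⟨k, rfl⟩ := Nat.exists_eq_add_of_le' h
    obtain ⟨i⟩ := hE.1 X Y f k
    exact surjective_of_arrowIso i (hf k)

end SingChain

namespace ChromConf

open SingChain Limits

section Homology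

variable (E : Type) [NormedAddCommGroup E] [NormedSpace ℝ E] {V : Type}

/-- The singular chain complex of a configuration space. -/
noncomputable abbrev confChains (G : SimpleGraph V) : ChainComplex (ModuleCat.{0} ℤ) ℕ :=
  singularChains.obj (TopCat.of (conf E G))

/-- The map in homology induced by an inclusion of configuration spaces. -/
noncomputable def confHomology {G G' : SimpleGraph V} (h : G ≤ G') (k : ℕ) :
    (confChains E G').homology k ⟶ (confChains E G).homology k :=
  HomologicalComplex.homologyMap (singularChains.map (TopCat.ofHom (confIncl E h))) k

lemma confHomology_comp {G G' G'' : SimpleGraph V} (h : G ≤ G') (h' : G' ≤ G'') (k : ℕ)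
    (x : (confChains E G'').homology k) :
    confHomology E h k (confHomology E h' k x) = confHomology E (h.trans h') k x := by
  have : confHomology E h' k ≫ confHomology E h k = confHomology E (h.trans h') k :=
    (HomologicalComplex.homologyMap_comp _ _ k).symm.trans
      (congrArg (HomologicalComplex.homologyMap · k) (singularChains.map_comp _ _).symm)
  exact ConcreteCategory.congr_hom this x

instance (V : Type) : ContractibleSpace (conf E (⊥ : SimpleGraph V)) := by
  have : conf E (⊥ : SimpleGraph V) = Set.univ :=
    Set.eq_univ_of_forall fun x u v huv => huv.elim
  rw [this]
  exact convex_univ.contractibleSpace Set.univ_nonempty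

lemma nonempty_conf [Infinite E] [Finite V] (G : SimpleGraph V) : Nonempty (conf E G) := by
  obtain ⟨f⟩ : Nonempty (V ↪ E) := by
    have := Fintype.ofFinite V
    exact ⟨(Fintype.equivFin V).toEmbedding.trans
      (Fin.valEmbedding.trans (Infinite.natEmbedding E))⟩
  exact ⟨f, fun u v huv h => huv.ne (f.injective h)⟩

lemma confHomology_bot_surjective [Infinite E] [Finite V] {G : SimpleGraph V} (h : ⊥ ≤ G) (k : ℕ) :
    Function.Surjective (confHomology E h k) := by
  obtain ⟨x⟩ := nonempty_conf E G
  have h1 := isIso_homologyMap (quasiIso_const (confIncl E h x)) k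
  have h2 : HomologicalComplex.homologyMap (singularChains.map
      (TopCat.ofHom (ContinuousMap.const PUnit.{1} x))) k ≫ confHomology E h k =
      HomologicalComplex.homologyMap (singularChains.map
        (TopCat.ofHom (ContinuousMap.const PUnit.{1} (confIncl E h x)))) k :=
    (HomologicalComplex.homologyMap_comp _ _ k).symm.trans
      (congrArg (HomologicalComplex.homologyMap · k) (singularChains.map_comp _ _).symm)
  rw [← ModuleCat.epi_iff_surjective]
  rw [← h2] at h1
  exact epi_of_epi (HomologicalComplex.homologyMap (singularChains.map
      (TopCat.ofHom (ContinuousMap.const PUnit.{1} x))) k) _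

variable {E} {n : ℕ}

lemma eq_bot_or_exists_adj (G : SimpleGraph V) : G = ⊥ ∨ ∃ i j, G.Adj i j := by
  by_contra! h
  exact h.1 (SimpleGraph.ext (funext₂ fun u v => by simpa using h.2 u v))

lemma del_lt {G : SimpleGraph V} {i j : V} (h : G.Adj i j) : del G i j < G :=
  lt_of_le_of_ne del_le fun he => (del_adj.1 (he.symm ▸ h : (del G i j).Adj i j)).2 rfl

lemma contr_eq_top (i j : V) : contr (⊤ : SimpleGraph V) i j = ⊤ := by
  ext u v
  exact ⟨fun h => h.1, fun h => ⟨h, Or.inl fun he => h (Subtype.ext he)⟩⟩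

theorem confHomology_surjective_of_eq_top (hE : HasThomIso E n) [Infinite E] (m : ℕ) :
    ∀ (V : Type) [Fintype V], Fintype.card V = m → ∀ (G G' : SimpleGraph V) (h : G ≤ G'),
      G' = ⊤ → ∀ k, Function.Surjective (confHomology E h k) := by
  induction m with
  | zero =>
    intro V _ hV G G' h _ k
    have := Fintype.card_eq_zero_iff.1 hV
    obtain rfl : G = ⊥ := Subsingleton.elim _ _
    exact confHomology_bot_surjective E h k
  | succ m ihm =>
    intro V _ hV G
    induction G using WellFoundedLT.induction with
    | _ G ih =>
      intro G' h hG' k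
      rcases eq_bot_or_exists_adj G with rfl | ⟨i, j, hij⟩
      · exact confHomology_bot_surjective E h k
      · classical
        have key := surjective_homologyMap_τ₁ (pairSeq.map (confPairMap E i j h))
          (@pairSeq_shortExact (confPair E G' i j) (inferInstanceAs (Mono (incl _))))
          (@pairSeq_shortExact (confPair E G i j) (inferInstanceAs (Mono (incl _)))) k ?_ ?_
        · exact key
        · intro x
          obtain ⟨y, hy⟩ := ih _ (del_lt hij) G' (del_le.trans h) hG' k
            (confHomology E del_le k x)
          exact ⟨y, (confHomology_comp E del_le h k y).trans hy⟩
        · obtain ⟨e⟩ := confPair_thom E h hij (k + 1)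
          refine surjective_of_arrowIso e (hE.surjective _ (fun l => ?_) (k + 1))
          refine ihm {v // v ≠ j} ?_ _ _ (contr_mono h) (by rw [hG', contr_eq_top]) l
          rw [Fintype.card_subtype_compl, Fintype.card_subtype_eq, hV]
          rfl

variable [Fintype V] {G : SimpleGraph V} {i j : V}

lemma confHomology_surjective (hE : HasThomIso E n) [Infinite E] {G G' : SimpleGraph V}
    (h : G ≤ G') (k : ℕ) : Function.Surjective (confHomology E h k) := by
  intro x
  obtain ⟨y, hy⟩ := confHomology_surjective_of_eq_top hE _ V rfl G ⊤ le_top rfl k x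
  exact ⟨confHomology E le_top k y, (confHomology_comp E h le_top k y).trans hy⟩

/-- The deletion–contraction recursion, before applying the Thom isomorphism. -/
lemma rank_homology_conf_del (hE : HasThomIso E n) [Infinite E] (h : G.Adj i j) (k : ℕ) :
    Module.rank ℤ ((confChains E G).homology k) =
      Module.rank ℤ ((confChains E (del G i j)).homology k) +
        Module.rank ℤ ((relF.obj (thomPair E (conf E (contr G i j)))).homology (k + 1)) := by
  obtain ⟨e⟩ := confPair_thom E (le_refl G) h (k + 1)
  refine (rank_homology_eq_add
    (@pairSeq_shortExact (confPair E G i j) (inferInstanceAs (Mono (incl _))))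
    (confHomology_surjective hE del_le) k).trans (congrArg (_ + ·) ?_)
  exact (Arrow.leftFunc.mapIso e).toLinearEquiv.rank_eq

lemma rank_homology_conf_of_lt (hE : HasThomIso E n) [Infinite E] (h : G.Adj i j) {k : ℕ}
    (hk : k + 1 < n) : Module.rank ℤ ((confChains E G).homology k) =
      Module.rank ℤ ((confChains E (del G i j)).homology k) := by
  have := ModuleCat.subsingleton_of_isZero (hE.2 (conf E (contr G i j)) (k + 1) hk)
  exact (rank_homology_conf_del hE h k).trans
    ((congrArg (_ + ·) (rank_subsingleton' ℤ _)).trans (add_zero _))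

/-- The deletion–contraction recursion for the Betti numbers. -/
lemma rank_homology_conf (hE : HasThomIso E n) [Infinite E] (h : G.Adj i j) {k l : ℕ}
    (hk : k + 1 = l + n) : Module.rank ℤ ((confChains E G).homology k) =
      Module.rank ℤ ((confChains E (del G i j)).homology k) +
        Module.rank ℤ ((confChains E (contr G i j)).homology l) := by
  obtain ⟨e⟩ := hE.1 _ _ (ContinuousMap.id (conf E (contr G i j))) l
  have he (q : ℕ) (hq : q = l + n) :
      Module.rank ℤ ((relF.obj (thomPair E (conf E (contr G i j)))).homology q) =
        Module.rank ℤ ((confChains E (contr G i j)).homology l) := by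
    subst hq
    exact (Arrow.leftFunc.mapIso e).toLinearEquiv.rank_eq
  exact (rank_homology_conf_del hE h k).trans (congrArg (_ + ·) (he _ hk))

end Homology

end ChromConf

namespace ChromConf

section Counting

variable {V : Type} [Finite V] {G : SimpleGraph V} {i j : V}

/-- The number of triangles of a graph. -/
noncomputable def triangles (G : SimpleGraph V) : ℕ :=
  Set.ncard {s : Finset V | s.card = 3 ∧ ∀ i ∈ s, ∀ j ∈ s, i ≠ j → G.Adj i j}

lemma ncard_edgeSet_bot : (⊥ : SimpleGraph V).edgeSet.ncard = 0 := by
  simp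

lemma triangles_bot : triangles (⊥ : SimpleGraph V) = 0 := by
  rw [triangles, Set.ncard_eq_zero]
  refine Set.eq_empty_of_forall_notMem fun s ⟨hs, h⟩ => ?_
  obtain ⟨x, hx, y, hy, hxy⟩ := Finset.one_lt_card.1 (by omega : 1 < s.card)
  exact h x hx y hy hxy

lemma ncard_edgeSet_del (h : G.Adj i j) : (del G i j).edgeSet.ncard + 1 = G.edgeSet.ncard := by
  have : (del G i j).edgeSet = G.edgeSet \ {s(i, j)} := by
    ext e
    induction e with
    | _ u v => simp [del_adj]
  rw [this, Set.ncard_sdiff_singleton_add_one ((G.mem_edgeSet).2 h)]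

lemma mk_mem_map_edgeSet_contr {u v : V} :
    s(u, v) ∈ Sym2.map Subtype.val '' (contr G i j).edgeSet ↔ u ≠ j ∧ v ≠ j ∧ u ≠ v ∧
      (G.Adj u v ∨ (u = i ∧ G.Adj j v) ∨ (v = i ∧ G.Adj j u)) := by
  constructor
  · rintro ⟨e, he, h⟩
    induction e with
    | _ a b =>
      obtain ⟨hne, hab⟩ := he
      have hne' := Subtype.val_injective.ne hne
      rcases Sym2.eq_iff.1 h with ⟨rfl, rfl⟩ | ⟨rfl, rfl⟩
      · exact ⟨a.2, b.2, hne', hab⟩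
      · exact ⟨b.2, a.2, hne'.symm, hab.imp SimpleGraph.Adj.symm Or.symm⟩
  · rintro ⟨hu, hv, hne, h⟩
    exact ⟨s(⟨u, hu⟩, ⟨v, hv⟩), ⟨fun he => hne (congrArg Subtype.val he), h⟩, rfl⟩

lemma ncard_edgeSet_contr (h : G.Adj i j) :
    (contr G i j).edgeSet.ncard + 1 + (G.commonNeighbors i j).ncard = G.edgeSet.ncard := by
  classical
  set A : Set (Sym2 V) := {e ∈ G.edgeSet | j ∉ e} with hA
  set B : Set V := {v | G.Adj j v ∧ ¬ G.Adj i v ∧ v ≠ i} with hB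
  have h1 : (contr G i j).edgeSet.ncard = A.ncard + B.ncard := by
    rw [← Set.ncard_image_of_injective _ (Sym2.map.injective Subtype.val_injective),
      ← Set.ncard_image_of_injective B (fun a b hab => (Sym2.congr_right (a := i)).1 hab),
      ← Set.ncard_union_eq]
    · congr 1
      ext e
      induction e with
      | _ u v =>
        rw [mk_mem_map_edgeSet_contr]
        have := G.adj_comm u v
        have := G.adj_comm j u
        have := G.adj_comm j v
        have := @G.ne_of_adj
        have := h.ne
        simp only [hA, hB, Set.mem_union, Set.mem_ofPred_eq, Set.mem_image, Sym2.mem_iff,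
          SimpleGraph.mem_edgeSet, Sym2.eq_iff]
        grind
    · rw [Set.disjoint_left]
      rintro _ h1 ⟨v, h2, rfl⟩
      exact h2.2.1 h1.1
  have h2 : G.edgeSet.ncard = A.ncard + (G.neighborSet j).ncard := by
    rw [← Set.ncard_image_of_injective (G.neighborSet j)
      (fun a b hab => (Sym2.congr_right (a := j)).1 hab), ← Set.ncard_union_eq]
    · congr 1
      ext e
      induction e with
      | _ u v =>
        have := G.adj_comm u v
        have := G.adj_comm j u
        have := G.adj_comm j v
        simp only [hA, Set.mem_union, Set.mem_ofPred_eq, Set.mem_image, Sym2.mem_iff,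
          SimpleGraph.mem_edgeSet, Sym2.eq_iff, SimpleGraph.mem_neighborSet]
        grind
    · rw [Set.disjoint_left]
      rintro _ h1 ⟨v, h2, rfl⟩
      exact h1.2 (Sym2.mem_mk_left _ _)
  have h3 : (G.neighborSet j).ncard = B.ncard + 1 + (G.commonNeighbors i j).ncard := by
    rw [← Set.ncard_insert_of_notMem (a := i) (s := B), ← Set.ncard_union_eq]
    · congr 1
      ext v
      have := h.symm
      have := G.irrefl (v := i)
      simp only [hB, Set.mem_union, Set.mem_insert_iff, Set.mem_ofPred_eq,
        SimpleGraph.mem_neighborSet, SimpleGraph.mem_commonNeighbors]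
      grind
    · rw [Set.disjoint_left]
      rintro v (rfl | h1) h2
      · exact G.irrefl h2.1
      · exact h1.2.1 h2.1
    · simp [hB]
  omega

lemma triangles_del (h : G.Adj i j) :
    triangles (del G i j) + (G.commonNeighbors i j).ncard = triangles G := by
  classical
  have hne (k : V) (hk : k ∈ G.commonNeighbors i j) : i ≠ j ∧ k ≠ i ∧ k ≠ j :=
    ⟨h.ne, hk.1.ne', hk.2.ne'⟩
  have hinj : Set.InjOn (fun k => ({i, j, k} : Finset V)) (G.commonNeighbors i j) := by
    intro k hk l hl hkl
    have h1 : k ∈ ({i, j, l} : Finset V) := by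
      rw [← show ({i, j, k} : Finset V) = {i, j, l} from hkl]
      simp
    have := hne k hk
    simp only [Finset.mem_insert, Finset.mem_singleton] at h1
    tauto
  rw [triangles, triangles, ← hinj.ncard_image, ← Set.ncard_union_eq]
  · congr 1
    ext s
    simp only [Set.mem_union, Set.mem_ofPred_eq, Set.mem_image]
    constructor
    · rintro (⟨hs, hd⟩ | ⟨k, hk, rfl⟩)
      · exact ⟨hs, fun u hu v hv huv => del_le (hd u hu v hv huv)⟩
      · refine ⟨Finset.card_eq_three.2 ⟨i, j, k, h.ne, hk.1.ne, hk.2.ne, rfl⟩, ?_⟩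
        have := h.symm
        have := hk.1
        have := hk.2
        have := hk.1.symm
        have := hk.2.symm
        simp only [Finset.mem_insert, Finset.mem_singleton]
        rintro u (rfl | rfl | rfl) v (rfl | rfl | rfl) huv <;> tauto
    · rintro ⟨hs, hd⟩
      by_cases hij : i ∈ s ∧ j ∈ s
      · obtain ⟨k, hk⟩ : ∃ k, k ∈ s \ {i, j} := by
          refine Finset.card_pos.1 ?_
          have := Finset.le_card_sdiff {i, j} s
          have := Finset.card_le_two (a := i) (b := j)
          omega
        simp only [Finset.mem_sdiff, Finset.mem_insert, Finset.mem_singleton, not_or] at hk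
        refine Or.inr ⟨k, ⟨hd i hij.1 k hk.1 (Ne.symm hk.2.1), hd j hij.2 k hk.1 (Ne.symm hk.2.2)⟩,
          Finset.eq_of_subset_of_card_le ?_ ?_⟩
        · simp [Finset.insert_subset_iff, hij, hk]
        · rw [hs, Finset.card_eq_three.2 ⟨i, j, k, h.ne, Ne.symm hk.2.1, Ne.symm hk.2.2, rfl⟩]
      · refine Or.inl ⟨hs, fun u hu v hv huv => del_adj.2 ⟨hd u hu v hv huv, fun he => hij ?_⟩⟩
        rcases Sym2.eq_iff.1 he with ⟨rfl, rfl⟩ | ⟨rfl, rfl⟩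
        exacts [⟨hu, hv⟩, ⟨hv, hu⟩]
  · rw [Set.disjoint_left]
    rintro _ ⟨_, h1⟩ ⟨k, hk, rfl⟩
    exact (del_adj.1 (h1 i (by simp) j (by simp) h.ne)).2 rfl

end Counting

end ChromConf

namespace ChromConf

open SingChain

section Betti

variable {E : Type} [NormedAddCommGroup E] [NormedSpace ℝ E] [Infinite E] {n : ℕ}
  {V : Type} [Fintype V]

lemma rank_homology_conf_bot (k : ℕ) :
    Module.rank ℤ ((confChains E (⊥ : SimpleGraph V)).homology k) = if k = 0 then 1 else 0 :=
  rank_homology_of_contractible (conf E (⊥ : SimpleGraph V)) k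

lemma rank_homology_conf_zero (hE : HasThomIso E n) (hn : 2 ≤ n) (G : SimpleGraph V) :
    Module.rank ℤ ((confChains E G).homology 0) = 1 := by
  induction G using WellFoundedLT.induction with
  | _ G ih =>
    rcases eq_bot_or_exists_adj G with rfl | ⟨i, j, h⟩
    · exact rank_homology_conf_bot 0
    · exact (rank_homology_conf_of_lt hE h (by omega)).trans (ih _ (del_lt h))

lemma rank_homology_conf_pred (hE : HasThomIso E n) (hn : 2 ≤ n) (G : SimpleGraph V) :
    Module.rank ℤ ((confChains E G).homology (n - 1)) = G.edgeSet.ncard := by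
  classical
  induction G using WellFoundedLT.induction with
  | _ G ih =>
    rcases eq_bot_or_exists_adj G with rfl | ⟨i, j, h⟩
    · rw [rank_homology_conf_bot, if_neg (by omega), ncard_edgeSet_bot, Nat.cast_zero]
    · rw [rank_homology_conf hE h (l := 0) (by omega), ih _ (del_lt h),
        rank_homology_conf_zero hE hn, ← ncard_edgeSet_del h, Nat.cast_succ]

lemma exists_rank_homology_conf (hE : HasThomIso E n) (hn : 2 ≤ n) (G : SimpleGraph V) :
    ∃ r : ℕ, Module.rank ℤ ((confChains E G).homology (2 * (n - 1))) = r ∧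
      r + triangles G = G.edgeSet.ncard.choose 2 := by
  classical
  induction G using WellFoundedLT.induction with
  | _ G ih =>
    rcases eq_bot_or_exists_adj G with rfl | ⟨i, j, h⟩
    · refine ⟨0, ?_, by rw [triangles_bot, ncard_edgeSet_bot]; rfl⟩
      rw [rank_homology_conf_bot, if_neg (by omega), Nat.cast_zero]
    · obtain ⟨r, hr, ht⟩ := ih _ (del_lt h)
      refine ⟨r + (contr G i j).edgeSet.ncard, ?_, ?_⟩
      · rw [rank_homology_conf hE h (l := n - 1) (by omega), hr, rank_homology_conf_pred hE hn,
          Nat.cast_add]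
      · have h1 := ncard_edgeSet_del h
        have h2 := ncard_edgeSet_contr h
        have h3 := triangles_del h
        rw [← h1, Nat.choose_succ_succ', Nat.choose_one_right, ← ht]
        omega

end Betti

end ChromConf

theorem stmt14 (m N : ℕ) (hN : 2 ≤ N)
    (G : SimpleGraph (Fin m)) (hG : G.Connected) :
    (Module.finrank ℤ (SH (2 * (N - 1)) (chromConf N m G)) : ℤ) =
      (Nat.card G.edgeSet).choose 2 - triangleCount G := by
  have : Nontrivial (EuclideanSpace ℝ (Fin N)) := by
    have : Nonempty (Fin N) := ⟨⟨0, by omega⟩⟩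
    infer_instance
  have : Infinite (EuclideanSpace ℝ (Fin N)) := Module.Free.infinite ℝ _
  obtain ⟨r, hr, ht⟩ := ChromConf.exists_rank_homology_conf (SingChain.hasThomIso_euclidean N) hN G
  have h1 : Module.finrank ℤ (SH (2 * (N - 1)) (chromConf N m G)) = r :=
    Module.finrank_eq_of_rank_eq hr
  have h2 : triangleCount G = ChromConf.triangles G := rfl
  have h3 : Nat.card G.edgeSet = G.edgeSet.ncard := rfl
  rw [h1, h2, h3, ← ht]
  push_cast
  ring
end

section
/- Let Γ be a finite simple graph and N ≥ 3. Then Conf_Γ(ℝ^N) is (N−2)-connected: it is nonempty and path-connected, simply connected, and its homotopy groups π_k(Conf_Γ(ℝ^N)) are trivial for all 1 ≤ k ≤ N−2. -/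
open Set Filter Topology Module in
/-- A continuous map can be approximated on an open set by a `C¹` map, with prescribed precision. -/
theorem exists_contDiffOn_approx {E F : Type*}
    [NormedAddCommGroup E] [NormedSpace ℝ E] [FiniteDimensional ℝ E]
    [NormedAddCommGroup F] [NormedSpace ℝ F] {O : Set E} (hO : IsOpen O)
    {f : E → F} (hf : Continuous f) {ε : E → ℝ} (hε : Continuous ε) (hpos : ∀ s ∈ O, 0 < ε s) :
    ∃ g : E → F, ContDiffOn ℝ 1 g O ∧ ∀ s ∈ O, dist (g s) (f s) < ε s := by
  classical
  let U : TopologicalSpace.Opens E := ⟨O, hO⟩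
  have : SigmaCompactSpace U := by
    have : LocallyCompactSpace U := hO.locallyCompactSpace
    have : SecondCountableTopology E := inferInstance
    infer_instance
  obtain ⟨g, hg, -⟩ := Continuous.exists_contMDiff_approx (M := U) (modelWithCornersSelf ℝ E) 1
    (f := fun s : U ↦ f s) (ε := fun s : U ↦ ε s) (hf.comp continuous_subtype_val)
    (hε.comp continuous_subtype_val) (fun s ↦ hpos s s.2)
  refine ⟨fun s ↦ if h : s ∈ O then g ⟨s, h⟩ else 0, fun s hs ↦ ?_, fun s hs ↦ ?_⟩
  · refine ContDiffAt.contDiffWithinAt (contMDiffAt_iff_contDiffAt.1 ?_)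
    refine (contMDiffAt_subtype_iff (U := U) (x := ⟨s, hs⟩)).1 ?_
    convert! g.contMDiff ⟨s, hs⟩ using 1
    ext t
    exact dif_pos t.2
  · simpa [hs] using hg ⟨s, hs⟩

open Set Filter Topology Module unitInterval in
/-- A map from the `n`-cube to `F ^ m` can be modified away from the boundary of the cube so that
the values of its coordinates at interior points are pairwise distinct, if `n < dim F`. -/
theorem exists_injective_on_interior_cube {F : Type*} [NormedAddCommGroup F] [NormedSpace ℝ F]
    [FiniteDimensional ℝ F] {n m : ℕ} (hn : n < finrank ℝ F) (K : C(I^ (Fin n), Fin m → F)) :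
    ∃ H : C(I^ (Fin n), Fin m → F), (∀ s ∈ Cube.boundary (Fin n), H s = K s) ∧
      ∀ s ∉ Cube.boundary (Fin n), Function.Injective (H s) := by
  classical
  let O : Set (Fin n → ℝ) := univ.pi fun _ ↦ Ioo 0 1
  have hO : IsOpen O := isOpen_set_pi finite_univ fun _ _ ↦ isOpen_Ioo
  have hconv : Convex ℝ O := convex_pi fun _ _ ↦ convex_Ioo 0 1
  let v : (I^ (Fin n)) → (Fin n → ℝ) := fun s i ↦ s i
  have hv : Continuous v := by fun_prop
  let φ : (Fin n → ℝ) → ℝ := fun s ↦ ∏ i, s i * (1 - s i)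
  have hφ : ContDiff ℝ 1 φ := by fun_prop
  have hφpos : ∀ s ∈ O, 0 < φ s := fun s hs ↦ Finset.prod_pos fun i _ ↦
    mul_pos (hs i trivial).1 (sub_pos.2 (hs i trivial).2)
  have hmem : ∀ s, s ∉ Cube.boundary (Fin n) ↔ v s ∈ O := by
    intro s
    simp only [Cube.boundary, mem_ofPred_eq, not_exists, not_or, O, v, mem_univ_pi, mem_Ioo,
      unitInterval.coe_pos, unitInterval.coe_lt_one, unitInterval.pos_iff_ne_zero,
      unitInterval.lt_one_iff_ne_one]
  have hφzero : ∀ s, v s ∉ O → φ (v s) = 0 := by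
    intro s hs
    obtain ⟨i, hi⟩ := not_not.1 (mt (hmem s).1 hs)
    refine Finset.prod_eq_zero (Finset.mem_univ i) ?_
    rcases hi with hi | hi <;> simp [v, hi]
  obtain ⟨g, hg, hgK⟩ := exists_contDiffOn_approx hO
    (f := fun s ↦ K fun i ↦ projIcc 0 1 zero_le_one (s i)) (by fun_prop) hφ.continuous hφpos
  let b : Fin m × Fin m → (Fin n → ℝ) → F := fun p s ↦
    -((((p.1 : ℝ) - (p.2 : ℝ)) * φ s)⁻¹ • (g s p.1 - g s p.2))
  have hb : ∀ p, dimH (b p '' O) ≤ n := by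
    intro p
    by_cases hp : p.1 = p.2
    · have : b p '' O ⊆ {0} := by
        rintro _ ⟨s, -, rfl⟩
        simp [b, hp]
      exact (dimH_mono this).trans (by simp)
    have hne : ((p.1 : ℝ) - (p.2 : ℝ)) ≠ 0 := by
      rw [sub_ne_zero]
      exact_mod_cast fun h ↦ hp (Fin.ext h)
    have hd : ContDiffOn ℝ 1 (b p) O := by
      have h1 := contDiffOn_pi.1 hg
      refine (ContDiffOn.smul (ContDiffOn.inv (contDiffOn_const.mul hφ.contDiffOn) ?_)
        ((h1 p.1).sub (h1 p.2))).neg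
      exact fun s hs ↦ mul_ne_zero hne (hφpos s hs).ne'
    calc dimH (b p '' O) ≤ dimH O := hd.dimH_image_le hconv subset_rfl
      _ ≤ dimH (univ : Set (Fin n → ℝ)) := dimH_mono (subset_univ _)
      _ = n := Real.dimH_univ_pi_fin n
  obtain ⟨q, hq⟩ : (⋃ p, b p '' O)ᶜ.Nonempty := by
    refine (dense_compl_of_dimH_lt_finrank ?_).nonempty
    rw [dimH_iUnion]
    exact (iSup_le hb).trans_lt (by exact_mod_cast hn)
  let w : Fin m → F := fun i ↦ (i : ℝ) • q
  let D : (I^ (Fin n)) → Fin m → F := fun s ↦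
    if v s ∈ O then g (v s) + φ (v s) • w - K s else 0
  have hproj : ∀ s, (fun i ↦ projIcc 0 1 zero_le_one (v s i)) = s := fun s ↦ by
    ext i
    simp [v]
  have hDbound : ∀ s, ‖D s‖ ≤ φ (v s) * (1 + ‖w‖) := by
    intro s
    by_cases hs : v s ∈ O
    · have h1 := (hgK _ hs).le
      rw [hproj, dist_eq_norm] at h1
      have h0 := hφpos _ hs
      calc ‖D s‖ = ‖(g (v s) - K s) + φ (v s) • w‖ := by
            simp only [D, if_pos hs]
            congr 1
            abel
        _ ≤ ‖g (v s) - K s‖ + ‖φ (v s) • w‖ := norm_add_le _ _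
        _ ≤ φ (v s) + φ (v s) * ‖w‖ := by
            rw [norm_smul, Real.norm_of_nonneg h0.le]
            gcongr
        _ = _ := by ring
    · simp [D, hs, hφzero s hs]
  have hDcont : Continuous D := by
    refine continuous_iff_continuousAt.2 fun s ↦ ?_
    by_cases hs : v s ∈ O
    · have hev : ∀ᶠ t in 𝓝 s, v t ∈ O := hv.continuousAt.eventually (hO.mem_nhds hs)
      have hgs : ContinuousAt g (v s) := (hg.continuousOn).continuousAt (hO.mem_nhds hs)
      have hc : ContinuousAt (fun t ↦ g (v t) + φ (v t) • w - K t) s :=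
        ((hgs.comp hv.continuousAt).add
          ((hφ.continuous.comp hv).smul continuous_const).continuousAt).sub
            K.continuous.continuousAt
      exact hc.congr (hev.mono fun t ht ↦ (if_pos ht).symm)
    · have hD0 : D s = 0 := if_neg hs
      rw [ContinuousAt, hD0]
      refine squeeze_zero_norm hDbound ?_
      have hc : Continuous fun t ↦ φ (v t) * (1 + ‖w‖) :=
        (hφ.continuous.comp hv).mul continuous_const
      simpa [hφzero s hs] using hc.tendsto s
  refine ⟨⟨fun s ↦ K s + D s, K.continuous.add hDcont⟩, fun s hs ↦ ?_, fun s hs i j hij ↦ ?_⟩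
  · have : v s ∉ O := fun h ↦ (hmem s).2 h hs
    simp [D, this]
  · have hsO := (hmem s).1 hs
    by_contra hne
    have hne' : ((i : ℝ) - (j : ℝ)) ≠ 0 := by
      rw [sub_ne_zero]
      exact_mod_cast fun h ↦ hne (Fin.ext h)
    refine hq (mem_iUnion.2 ⟨(i, j), v s, hsO, ?_⟩)
    simp only [ContinuousMap.coe_mk, D, if_pos hsO, Pi.add_apply, Pi.sub_apply, Pi.smul_apply,
      w] at hij
    have h0 := (hφpos _ hsO).ne'
    have key : g (v s) i - g (v s) j = -((((i : ℝ) - j) * φ (v s)) • q) := by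
      rw [← sub_eq_zero] at hij ⊢
      rw [← hij]
      module
    simp only [b]
    rw [key, smul_neg, neg_neg, inv_smul_smul₀ (mul_ne_zero hne' h0)]

open unitInterval Topology in
theorem nonempty_chromConf {N : ℕ} (hN : 0 < N) (m : ℕ) (G : SimpleGraph (Fin m)) :
    Nonempty (chromConf N m G) := by
  obtain ⟨H, -, hH⟩ := exists_injective_on_interior_cube (F := EuclideanSpace ℝ (Fin N)) (n := 0)
    (m := m) (by simpa using hN) (ContinuousMap.const _ 0)
  exact ⟨⟨H 0, fun i j hij h ↦ hij.ne (hH 0 (fun ⟨i, _⟩ ↦ i.elim0) h)⟩⟩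

open unitInterval Topology in
/-- A map from the boundary of the `n`-cube to `Conf_Γ(ℝ^N)` which extends to the cube as a map to
`(ℝ^N)^m` also extends to the cube as a map to `Conf_Γ(ℝ^N)`, if `n < N`. -/
theorem exists_extension_chromConf {n N m : ℕ} (hn : n < N) (G : SimpleGraph (Fin m))
    (K : C(I^ (Fin n), Fin m → EuclideanSpace ℝ (Fin N)))
    (hK : ∀ s ∈ Cube.boundary (Fin n), ∀ i j, G.Adj i j → K s i ≠ K s j) :
    ∃ H : C(I^ (Fin n), chromConf N m G),
      ∀ s ∈ Cube.boundary (Fin n), (H s : Fin m → EuclideanSpace ℝ (Fin N)) = K s := by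
  obtain ⟨H, hHK, hH⟩ := exists_injective_on_interior_cube (by simpa using hn) K
  refine ⟨⟨fun s ↦ ⟨H s, fun i j hij h ↦ ?_⟩, by fun_prop⟩, hHK⟩
  by_cases hs : s ∈ Cube.boundary (Fin n)
  · rw [hHK s hs] at h
    exact hK s hs i j hij h
  · exact hij.ne (hH s hs h)

open unitInterval Topology in
theorem joined_chromConf {N m : ℕ} (hN : 1 < N) (G : SimpleGraph (Fin m))
    (x y : chromConf N m G) : Joined x y := by
  let K : C(I^ (Fin 1), Fin m → EuclideanSpace ℝ (Fin N)) :=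
    ⟨fun s ↦ (1 - (s 0 : ℝ)) • x.1 + (s 0 : ℝ) • y.1, by fun_prop⟩
  have hK0 : K (fun _ ↦ 0) = x.1 := by simp [K]
  have hK1 : K (fun _ ↦ 1) = y.1 := by simp [K]
  obtain ⟨H, hH⟩ := exists_extension_chromConf hN G K (by
    rintro s ⟨i, hi⟩
    rw [eq_const_of_unique s, ← Subsingleton.elim i default]
    rcases hi with hi | hi <;> rw [hi]
    exacts [hK0 ▸ x.2, hK1 ▸ y.2])
  exact ⟨⟨⟨fun t ↦ H fun _ ↦ t, by fun_prop⟩,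
    Subtype.ext ((hH _ ⟨0, Or.inl rfl⟩).trans hK0), Subtype.ext ((hH _ ⟨0, Or.inr rfl⟩).trans hK1)⟩⟩

open unitInterval Topology in
theorem homotopic_const_chromConf {k N m : ℕ} (hk : k + 1 < N) (G : SimpleGraph (Fin m))
    (x : chromConf N m G) (f : GenLoop (Fin k) (chromConf N m G) x) :
    GenLoop.Homotopic f GenLoop.const := by
  let K : C(I^ (Fin (k + 1)), Fin m → EuclideanSpace ℝ (Fin N)) :=
    ⟨fun s ↦ (1 - (s 0 : ℝ)) • (f.1 (Fin.tail s)).1 + (s 0 : ℝ) • x.1, by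
      have : Continuous fun s : I^ (Fin (k + 1)) ↦ (f.1 (Fin.tail s)).1 :=
        continuous_subtype_val.comp (f.1.continuous.comp (by unfold Fin.tail; fun_prop))
      fun_prop⟩
  have hK (t : I) (y : I^ (Fin k)) :
      K (Fin.cons t y) = (1 - (t : ℝ)) • (f.1 y).1 + (t : ℝ) • x.1 := by
    simp [K]
  have hK0 (y : I^ (Fin k)) : K (Fin.cons 0 y) = (f.1 y).1 := by simp [hK]
  have hK1 (y : I^ (Fin k)) : K (Fin.cons 1 y) = x.1 := by simp [hK]
  have hKb (t : I) (y : I^ (Fin k)) (hy : y ∈ Cube.boundary (Fin k)) :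
      K (Fin.cons t y) = x.1 := by
    rw [hK, f.2 y hy]
    module
  obtain ⟨H, hH⟩ := exists_extension_chromConf hk G K (by
    intro s hs
    obtain ⟨t, y, rfl⟩ : ∃ t y, s = Fin.cons t y := ⟨s 0, Fin.tail s, (Fin.cons_self_tail s).symm⟩
    obtain ⟨i, hi⟩ := hs
    induction i using Fin.cases with
    | zero =>
      simp only [Fin.cons_zero] at hi
      rcases hi with rfl | rfl
      exacts [hK0 y ▸ (f.1 y).2, hK1 y ▸ x.2]
    | succ i =>
      simp only [Fin.cons_succ] at hi
      exact hKb t y ⟨i, hi⟩ ▸ x.2)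
  have hb (t : I) (y : I^ (Fin k)) (hy : y ∈ Cube.boundary (Fin k)) :
      (Fin.cons t y : I^ (Fin (k + 1))) ∈ Cube.boundary (Fin (k + 1)) := by
    obtain ⟨i, hi⟩ := hy
    exact ⟨i.succ, by simpa using hi⟩
  refine ⟨⟨⟨⟨fun p ↦ H (Fin.cons p.1 p.2), ?_⟩, fun y ↦ ?_, fun y ↦ ?_⟩, fun t y hy ↦ ?_⟩⟩
  · exact H.continuous.comp (Continuous.finCons (A := fun _ ↦ I) continuous_fst continuous_snd)
  · exact Subtype.ext ((hH _ ⟨0, Or.inl rfl⟩).trans (hK0 y))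
  · exact Subtype.ext ((hH _ ⟨0, Or.inr rfl⟩).trans (hK1 y))
  · exact Subtype.ext ((hH _ (hb t y hy)).trans ((hKb t y hy).trans
      (congrArg Subtype.val (f.2 y hy)).symm))

theorem subsingleton_homotopyGroup_chromConf {k N m : ℕ} (hk : k + 1 < N)
    (G : SimpleGraph (Fin m)) (x : chromConf N m G) :
    Subsingleton (HomotopyGroup (Fin k) (chromConf N m G) x) := by
  refine subsingleton_of_forall_eq (Quotient.mk _ GenLoop.const) fun a ↦ ?_
  induction a using Quotient.inductionOn with
  | h f => exact Quotient.sound (homotopic_const_chromConf hk G x f)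

theorem stmt15 (m N : ℕ) (hN : 3 ≤ N) (G : SimpleGraph (Fin m)) :
    Nonempty (chromConf N m G) ∧
    PathConnectedSpace (chromConf N m G) ∧
    SimplyConnectedSpace (chromConf N m G) ∧
    (∀ k : ℕ, 1 ≤ k → k ≤ N - 2 → ∀ x : chromConf N m G,
      Subsingleton (HomotopyGroup (Fin k) (chromConf N m G) x)) := by
  have hne := nonempty_chromConf (by omega : 0 < N) m G
  have hpath : PathConnectedSpace (chromConf N m G) :=
    ⟨hne, joined_chromConf (by omega) G⟩
  refine ⟨hne, hpath, simply_connected_iff_loops_nullhomotopic.2 ⟨hpath, fun x γ ↦ ?_⟩,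
    fun k _ hk x ↦ subsingleton_homotopyGroup_chromConf (by omega) G x⟩
  have := subsingleton_homotopyGroup_chromConf (by omega : 1 + 1 < N) G x
  have := (HomotopyGroup.pi1EquivFundamentalGroup (x := x)).symm.subsingleton
  exact Path.Homotopic.Quotient.eq.1 (Subsingleton.elim (α := FundamentalGroup (chromConf N m G) x)
    (Path.Homotopic.Quotient.mk γ) (Path.Homotopic.Quotient.mk (Path.refl x)))
end
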